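/- arXiv:1909.02429 — 6 statements merged into one kernel-verified Lean document; each statement's English description precedes it below -/
import Mathlib

section
/- Let s ∈ (0,1), a = 1−2s, c > 0 and A ∈ ℝ. Define g : (0,1] → ℝ by g(y) := A · Γ(1−s) · (c/2)^s · y^s · [ I_{−s}(c·y) − (I_{1−s}(c)/I_{s−1}(c)) · I_s(c·y) ]. Then: (i) g satisfies the weighted ODE y·g''(y) + a·g'(y) − c²·y·g(y) = 0 for every y ∈ (0,1); (ii) g(y) → A as y → 0⁺; (iii) g'(1) = 0; (iv) y^a·g'(y) → −S, where S := 2^{1−2s}·(Γ(1−s)/Γ(s))·(I_{1−s}(c)/I_{s−1}(c))·c^{2s}·A. (This is the per-frequency content of Theorem 1.1: the Dirichlet-to-Neumann symbol of the problem div(y^a ∇v)=0 on ℝⁿ×(0,1), v_y(·,1)=0, v(·,0)=u, at frequency |ξ| = c, equals S_s(c) = 2^{1−2s}(Γ(1−s)/Γ(s))·(I_{1−s}(c)/I_{s−1}(c))·c^{2s}.) -/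
open MeasureTheory Filter

/-- Modified Bessel function of the first kind, defined by its power series. -/
noncomputable def besselI (ν x : ℝ) : ℝ :=
  ∑' k : ℕ, (x / 2) ^ (2 * (k : ℝ) + ν) / ((k.factorial : ℝ) * Real.Gamma ((k : ℝ) + ν + 1))

/-- The entire function `t ↦ ∑ tᵏ / (k! Γ(k + ν + 1))`, for which
`besselI ν x = (x / 2) ^ ν * besselEntire ν ((x / 2) ^ 2)`. -/
noncomputable def besselEntire (ν t : ℝ) : ℝ :=
  ∑' k : ℕ, t ^ k / ((k.factorial : ℝ) * Real.Gamma ((k : ℝ) + ν + 1))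

theorem summable_besselEntire (ν t : ℝ) :
    Summable fun k : ℕ => t ^ k / ((k.factorial : ℝ) * Real.Gamma ((k : ℝ) + ν + 1)) := by
  refine Summable.of_norm_bounded_eventually_nat (Real.summable_pow_div_factorial |t|) ?_
  filter_upwards [eventually_ge_atTop ⌈1 - ν⌉₊] with k hk
  have hk' : 2 ≤ (k : ℝ) + ν + 1 := by linarith [Nat.ceil_le.mp hk]
  have hΓ : 1 ≤ Real.Gamma ((k : ℝ) + ν + 1) := by
    simpa only [Real.Gamma_two] using
      Real.Gamma_strictMonoOn_Ici.monotoneOn Set.self_mem_Ici hk' hk'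
  rw [norm_div, norm_mul, norm_pow, Real.norm_eq_abs, Real.norm_natCast,
    Real.norm_of_nonneg (by linarith)]
  gcongr
  exact le_mul_of_one_le_right (by positivity) hΓ

theorem succ_mul_div_factorial_Gamma (ν x : ℝ) (k : ℕ) :
    ((k + 1 : ℕ) : ℝ) * x / (((k + 1).factorial : ℝ) * Real.Gamma (((k + 1 : ℕ) : ℝ) + ν + 1)) =
      x / ((k.factorial : ℝ) * Real.Gamma ((k : ℝ) + (ν + 1) + 1)) := by
  rw [Nat.factorial_succ, Nat.cast_mul, mul_assoc,
    mul_div_mul_left _ _ (Nat.cast_ne_zero.mpr k.succ_ne_zero)]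
  congr 3
  push_cast
  ring

theorem summable_besselEntire_deriv (ν t : ℝ) :
    Summable fun k : ℕ =>
      (k : ℝ) * t ^ (k - 1) / ((k.factorial : ℝ) * Real.Gamma ((k : ℝ) + ν + 1)) := by
  rw [← summable_nat_add_iff 1]
  simpa only [succ_mul_div_factorial_Gamma, Nat.add_sub_cancel]
    using summable_besselEntire (ν + 1) t

theorem tsum_besselEntire_deriv (ν t : ℝ) :
    ∑' k : ℕ, (k : ℝ) * t ^ (k - 1) / ((k.factorial : ℝ) * Real.Gamma ((k : ℝ) + ν + 1)) =
      besselEntire (ν + 1) t := by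
  rw [(summable_besselEntire_deriv ν t).tsum_eq_zero_add]
  simp only [succ_mul_div_factorial_Gamma, Nat.add_sub_cancel, Nat.cast_zero, zero_mul, zero_div,
    zero_add, besselEntire]

theorem hasDerivAt_besselEntire (ν t : ℝ) :
    HasDerivAt (besselEntire ν) (besselEntire (ν + 1) t) t := by
  rw [← tsum_besselEntire_deriv]
  have hu := (summable_besselEntire_deriv ν (|t| + 1)).norm
  refine hasDerivAt_tsum_of_isPreconnected (t := Metric.ball 0 (|t| + 1)) (y₀ := t) hu
    Metric.isOpen_ball (convex_ball _ _).isPreconnected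
    (fun k y _ => (hasDerivAt_pow k y).div_const _) (fun k y hy => ?_) ?_
    (summable_besselEntire ν t) ?_
  · rw [mem_ball_zero_iff] at hy
    simp only [norm_div, norm_mul, norm_pow]
    gcongr
    exact hy.le.trans (le_abs_self _)
  all_goals simp

theorem besselEntire_sub_one (ν t : ℝ) :
    besselEntire (ν - 1) t = ν * besselEntire ν t + t * besselEntire (ν + 1) t := by
  rw [← tsum_besselEntire_deriv]
  unfold besselEntire
  rw [← tsum_mul_left, ← tsum_mul_left,
    ← ((summable_besselEntire ν t).mul_left ν).tsum_add
      ((summable_besselEntire_deriv ν t).mul_left t)]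
  refine tsum_congr fun k => ?_
  have hk : t * ((k : ℝ) * t ^ (k - 1)) = k * t ^ k := by
    rcases k with _ | k
    · simp
    · simp [pow_succ]; ring
  have hΓ : (Real.Gamma ((k : ℝ) + (ν - 1) + 1))⁻¹ =
      (k + ν) * (Real.Gamma ((k : ℝ) + ν + 1))⁻¹ := by
    rw [show (k : ℝ) + (ν - 1) + 1 = k + ν by ring]
    rcases eq_or_ne ((k : ℝ) + ν) 0 with h | h
    · simp [h, Real.Gamma_zero]
    · rw [Real.Gamma_add_one h, mul_inv, mul_inv_cancel_left₀ h]
  rw [mul_div_assoc', mul_div_assoc', hk]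
  simp only [div_eq_mul_inv, mul_inv, hΓ]
  ring

theorem besselEntire_zero (ν : ℝ) : besselEntire ν 0 = (Real.Gamma (ν + 1))⁻¹ := by
  unfold besselEntire
  rw [tsum_eq_single 0 fun k hk => by simp [hk]]
  simp

theorem besselEntire_pos {ν t : ℝ} (hν : -1 < ν) (ht : 0 ≤ t) : 0 < besselEntire ν t := by
  have hΓ : ∀ k : ℕ, 0 < Real.Gamma ((k : ℝ) + ν + 1) := fun k =>
    Real.Gamma_pos_of_pos (by linarith [k.cast_nonneg (α := ℝ)])
  refine (summable_besselEntire ν t).tsum_pos (fun k => ?_) 0 ?_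
  · have := hΓ k
    positivity
  · have := hΓ 0
    rw [pow_zero]
    positivity

theorem besselI_eq_rpow_mul_besselEntire (ν : ℝ) {x : ℝ} (hx : 0 < x) :
    besselI ν x = (x / 2) ^ ν * besselEntire ν ((x / 2) ^ 2) := by
  unfold besselI besselEntire
  rw [← tsum_mul_left]
  refine tsum_congr fun k => ?_
  rw [Real.rpow_add (half_pos hx), ← pow_mul, ← Real.rpow_natCast _ (2 * k)]
  push_cast
  ring

theorem hasDerivAt_besselEntire_mul_sq (ν κ y : ℝ) :
    HasDerivAt (fun z => besselEntire ν (κ * z ^ 2))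
      (2 * κ * y * besselEntire (ν + 1) (κ * y ^ 2)) y := by
  have h := (hasDerivAt_besselEntire ν (κ * y ^ 2)).comp y ((hasDerivAt_pow 2 y).const_mul κ)
  refine h.congr_deriv ?_
  push_cast
  ring

theorem hasDerivAt_rpow_mul_besselEntire (ν κ : ℝ) {y : ℝ} (hy : 0 < y) :
    HasDerivAt (fun z => z ^ (2 * ν) * besselEntire ν (κ * z ^ 2))
      (2 * y ^ (2 * ν - 1) * besselEntire (ν - 1) (κ * y ^ 2)) y := by
  have h := (Real.hasDerivAt_rpow_const (p := 2 * ν) (Or.inl hy.ne')).mul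
    (hasDerivAt_besselEntire_mul_sq ν κ y)
  refine h.congr_deriv ?_
  have hp : y ^ (2 * ν) = y ^ (2 * ν - 1) * y := by
    rw [← Real.rpow_add_one hy.ne', sub_add_cancel]
  rw [besselEntire_sub_one, hp]
  ring

theorem tendsto_besselEntire_mul_sq (ν κ : ℝ) :
    Tendsto (fun z => besselEntire ν (κ * z ^ 2)) (nhdsWithin 0 (Set.Ioi 0))
      (nhds (Real.Gamma (ν + 1))⁻¹) := by
  have h := (hasDerivAt_besselEntire_mul_sq ν κ 0).continuousAt.tendsto
  rw [zero_pow two_ne_zero, mul_zero, besselEntire_zero] at h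
  exact h.mono_left nhdsWithin_le_nhds

theorem tendsto_rpow_nhdsGT_zero {p : ℝ} (hp : 0 < p) :
    Tendsto (fun z : ℝ => z ^ p) (nhdsWithin 0 (Set.Ioi 0)) (nhds 0) := by
  have h := (Real.continuousAt_rpow_const 0 p (Or.inr hp.le)).tendsto
  rw [Real.zero_rpow hp.ne'] at h
  exact h.mono_left nhdsWithin_le_nhds

/-- Per-frequency content of Theorem 1.1: the extension `g` at frequency `c` solves the
weighted ODE, attains the boundary values, and its weighted Neumann derivative at `y = 0`
equals minus the Dirichlet-to-Neumann symbol `S`. -/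
theorem stmt0 (s : ℝ) (hs : s ∈ Set.Ioo (0 : ℝ) 1) (a : ℝ) (ha : a = 1 - 2 * s)
    (c : ℝ) (hc : 0 < c) (A : ℝ) (g : ℝ → ℝ)
    (hg : ∀ y : ℝ, 0 < y →
      g y = A * Real.Gamma (1 - s) * (c / 2) ^ s * y ^ s *
        (besselI (-s) (c * y) - besselI (1 - s) c / besselI (s - 1) c * besselI s (c * y)))
    (S : ℝ)
    (hS : S = (2 : ℝ) ^ (1 - 2 * s) * (Real.Gamma (1 - s) / Real.Gamma s) *
      (besselI (1 - s) c / besselI (s - 1) c) * c ^ (2 * s) * A) :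
    (∀ y ∈ Set.Ioo (0 : ℝ) 1,
        y * deriv (deriv g) y + a * deriv g y - c ^ 2 * y * g y = 0) ∧
    Tendsto g (nhdsWithin 0 (Set.Ioi 0)) (nhds A) ∧
    deriv g 1 = 0 ∧
    Tendsto (fun y : ℝ => y ^ a * deriv g y) (nhdsWithin 0 (Set.Ioi 0)) (nhds (-S)) := by
  obtain ⟨hs0, hs1⟩ := hs
  have hc2 : 0 < c / 2 := half_pos hc
  set κ : ℝ := (c / 2) ^ 2 with hκ
  set G : ℝ := Real.Gamma (1 - s)
  set R : ℝ := besselI (1 - s) c / besselI (s - 1) c with hR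
  set q : ℝ := (c / 2) ^ (2 * s) with hq
  set H : ℝ → ℝ := fun y => A * G * (2 * κ * (y ^ (2 * (1 - s)) * besselEntire (1 - s) (κ * y ^ 2))
    - 2 * R * q * besselEntire (s - 1) (κ * y ^ 2)) with hH
  have hG : G ≠ 0 := (Real.Gamma_pos_of_pos (by linarith)).ne'
  have hg' : ∀ y : ℝ, 0 < y → g y = A * G *
      (besselEntire (-s) (κ * y ^ 2) - R * q * (y ^ (2 * s) * besselEntire s (κ * y ^ 2))) := by
    intro y hy
    have hτ : (c * y / 2) ^ 2 = κ * y ^ 2 := by rw [hκ]; ring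
    rw [hg y hy, besselI_eq_rpow_mul_besselEntire _ (mul_pos hc hy),
      besselI_eq_rpow_mul_besselEntire _ (mul_pos hc hy), hτ,
      show c * y / 2 = c / 2 * y by ring, Real.mul_rpow hc2.le hy.le, Real.mul_rpow hc2.le hy.le,
      Real.rpow_neg hc2.le, Real.rpow_neg hy.le, hq, two_mul, Real.rpow_add hc2, Real.rpow_add hy]
    have h1 : (c / 2) ^ s ≠ 0 := (Real.rpow_pos_of_pos hc2 s).ne'
    have h2 : y ^ s ≠ 0 := (Real.rpow_pos_of_pos hy s).ne'
    field_simp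
  have hev : ∀ y : ℝ, 0 < y → g =ᶠ[nhds y] fun y => A * G *
      (besselEntire (-s) (κ * y ^ 2) - R * q * (y ^ (2 * s) * besselEntire s (κ * y ^ 2))) :=
    fun y hy => (lt_mem_nhds hy).mono hg'
  have hderiv : ∀ y : ℝ, 0 < y → deriv g y = y ^ (2 * s - 1) * H y := by
    intro y hy
    have h := ((hasDerivAt_besselEntire_mul_sq (-s) κ y).sub
      ((hasDerivAt_rpow_mul_besselEntire s κ hy).const_mul (R * q))).const_mul (A * G)
    rw [(hev y hy).deriv_eq]
    refine h.deriv.trans ?_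
    have hp : y ^ (2 * s - 1) * y ^ (2 * (1 - s)) = y := by
      rw [← Real.rpow_add hy, show 2 * s - 1 + 2 * (1 - s) = 1 by ring, Real.rpow_one]
    rw [neg_add_eq_sub]
    linear_combination (-2 * A * G * κ * besselEntire (1 - s) (κ * y ^ 2)) * hp
  have hHderiv : ∀ y : ℝ, 0 < y →
      HasDerivAt H (4 * κ * (y ^ (1 - 2 * s) * g y)) y := by
    intro y hy
    have h := (((hasDerivAt_rpow_mul_besselEntire (1 - s) κ hy).const_mul (2 * κ)).sub
      ((hasDerivAt_besselEntire_mul_sq (s - 1) κ y).const_mul (2 * R * q))).const_mul (A * G)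
    refine h.congr_deriv ?_
    have hp : y ^ (1 - 2 * s) * y ^ (2 * s) = y := by
      rw [← Real.rpow_add hy, sub_add_cancel, Real.rpow_one]
    rw [hg' y hy, show 2 * (1 - s) - 1 = 1 - 2 * s by ring, show 1 - s - 1 = -s by ring,
      sub_add_cancel]
    linear_combination (4 * κ * A * G * R * q * besselEntire s (κ * y ^ 2)) * hp
  refine ⟨fun y hy => ?_, ?_, ?_, ?_⟩
  · have hy0 := hy.1
    have h := ((Real.hasDerivAt_rpow_const (p := 2 * s - 1) (Or.inl hy0.ne')).mul
      (hHderiv y hy0)).deriv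
    have hev' : deriv g =ᶠ[nhds y] (fun z => z ^ (2 * s - 1)) * H :=
      (lt_mem_nhds hy0).mono hderiv
    rw [hev'.deriv_eq, h, hderiv y hy0, ha]
    have hp1 : y ^ (2 * s - 1) = y ^ (2 * s - 1 - 1) * y := by
      rw [← Real.rpow_add_one hy0.ne', sub_add_cancel]
    have hp2 : y ^ (2 * s - 1) * y ^ (1 - 2 * s) = 1 := by
      rw [← Real.rpow_add hy0, show 2 * s - 1 + (1 - 2 * s) = 0 by ring, Real.rpow_zero]
    have hκ4 : 4 * κ = c ^ 2 := by rw [hκ]; ring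
    linear_combination (-(2 * s - 1) * H y) * hp1 + 4 * κ * y * g y * hp2 + y * g y * hκ4
  · have h := ((tendsto_besselEntire_mul_sq (-s) κ).sub
      (((tendsto_rpow_nhdsGT_zero (p := 2 * s) (by linarith)).mul
        (tendsto_besselEntire_mul_sq s κ)).const_mul (R * q))).const_mul (A * G)
    rw [neg_add_eq_sub, zero_mul, mul_zero, sub_zero, mul_inv_cancel_right₀ hG] at h
    refine h.congr' ?_
    filter_upwards [self_mem_nhdsWithin] with y hy using (hg' y hy).symm
  · have hE := besselEntire_pos (ν := s - 1) (by linarith) (sq_nonneg (c / 2))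
    have hRq : R * q * besselEntire (s - 1) κ = κ * besselEntire (1 - s) κ := by
      have hpow : (c / 2) ^ (1 - s) * q = κ * (c / 2) ^ (s - 1) := by
        rw [hκ, hq, ← Real.rpow_natCast, ← Real.rpow_add hc2, ← Real.rpow_add hc2]
        congr 1
        push_cast
        ring
      have hne : (c / 2) ^ (s - 1) ≠ 0 := (Real.rpow_pos_of_pos hc2 _).ne'
      rw [hR, besselI_eq_rpow_mul_besselEntire _ hc, besselI_eq_rpow_mul_besselEntire _ hc, ← hκ]
      rw [← hκ] at hE
      have hE' := hE.ne'
      field_simp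
      linear_combination besselEntire (1 - s) κ * hpow
    rw [hderiv 1 one_pos, hH]
    simp only [Real.one_rpow, one_pow, mul_one, one_mul]
    linear_combination (-2 * A * G) * hRq
  · have h := ((((tendsto_rpow_nhdsGT_zero (p := 2 * (1 - s)) (by linarith)).mul
      (tendsto_besselEntire_mul_sq (1 - s) κ)).const_mul (2 * κ)).sub
      ((tendsto_besselEntire_mul_sq (s - 1) κ).const_mul (2 * R * q))).const_mul (A * G)
    have hlim : A * G * (2 * κ * (0 * (Real.Gamma (1 - s + 1))⁻¹) -
        2 * R * q * (Real.Gamma (s - 1 + 1))⁻¹) = -S := by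
      have h2 : (2 : ℝ) ^ (2 * s) ≠ 0 := (Real.rpow_pos_of_pos two_pos _).ne'
      rw [hS, hq, sub_add_cancel, Real.div_rpow hc.le two_pos.le, Real.rpow_sub two_pos,
        Real.rpow_one]
      ring
    rw [hlim] at h
    refine h.congr' ?_
    filter_upwards [self_mem_nhdsWithin] with y hy
    rw [hderiv y hy, ha, ← mul_assoc (y ^ (1 - 2 * s)), ← Real.rpow_add hy,
      show 1 - 2 * s + (2 * s - 1) = 0 by ring, Real.rpow_zero, one_mul]
end

section
/- For every s ∈ (0,1), the rescaled symbol tends to an explicit positive constant at zero frequency: 2^{1−2s}·(Γ(1−s)/Γ(s)) · r^{2s−2} · I_{1−s}(r)/I_{s−1}(r) → 1/(2(1−s)) as r → 0⁺. Equivalently, S_s(ξ)/|ξ|² → 1/(2(1−s)) as |ξ| → 0, ξ ≠ 0; in particular the symbol S_s behaves like the symbol |ξ|² of the classical Laplacian for small frequencies (first part of the asymptotics in Theorem 1.1). -/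
open MeasureTheory Filter

noncomputable def Cs (s : ℝ) : ℝ := (2 : ℝ) ^ (1 - 2 * s) * Real.Gamma (1 - s) / Real.Gamma s

open Classical in
noncomputable def Stilde {n : ℕ} (s : ℝ) (ξ : EuclideanSpace ℝ (Fin n)) : ℝ :=
  if ξ = 0 then 0 else Cs s * besselI (1 - s) ‖ξ‖ / besselI (s - 1) ‖ξ‖

noncomputable def symbolS {n : ℕ} (s : ℝ) (ξ : EuclideanSpace ℝ (Fin n)) : ℝ :=
  ‖ξ‖ ^ (2 * s) * Stilde s ξ

lemma Gamma_add_nat_ge {a : ℝ} (ha : 0 < a) (k : ℕ) :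
    a ^ k * Real.Gamma a ≤ Real.Gamma ((k : ℝ) + a) := by
  induction k with
  | zero => simp
  | succ k ih =>
    have hk : (0 : ℝ) < (k : ℝ) + a := by positivity
    have hrec : Real.Gamma (((k + 1 : ℕ) : ℝ) + a) = (k + a) * Real.Gamma ((k : ℝ) + a) := by
      rw [← Real.Gamma_add_one hk.ne']
      push_cast
      ring_nf
    rw [hrec, pow_succ']
    calc a * a ^ k * Real.Gamma a = a * (a ^ k * Real.Gamma a) := by ring
      _ ≤ (k + a) * Real.Gamma ((k : ℝ) + a) := by
        have hΓ := Real.Gamma_pos_of_pos ha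
        have hle : a ≤ k + a := by linarith [(Nat.cast_nonneg k : (0 : ℝ) ≤ k)]
        gcongr

lemma summable_inv_factorial_mul_Gamma {a : ℝ} (ha : 0 < a) :
    Summable fun k : ℕ => 1 / ((k.factorial : ℝ) * Real.Gamma ((k : ℝ) + a)) := by
  have hΓ := Real.Gamma_pos_of_pos ha
  refine Summable.of_nonneg_of_le (fun k => ?_) (fun k => ?_)
    ((Real.summable_pow_div_factorial a⁻¹).mul_left (Real.Gamma a)⁻¹)
  · have := Real.Gamma_pos_of_pos (show (0 : ℝ) < (k : ℝ) + a by positivity)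
    positivity
  · have heq : (Real.Gamma a)⁻¹ * (a⁻¹ ^ k / (k.factorial : ℝ)) =
        1 / ((k.factorial : ℝ) * (a ^ k * Real.Gamma a)) := by
      rw [inv_pow]
      field_simp
    rw [heq]
    have := Gamma_add_nat_ge ha k
    gcongr

lemma besselI_eq_rpow_mul (ν : ℝ) {x : ℝ} (hx : 0 < x) :
    besselI ν x = (x / 2) ^ ν *
      ∑' k : ℕ, (x / 2) ^ (2 * k) / ((k.factorial : ℝ) * Real.Gamma ((k : ℝ) + (ν + 1))) := by
  rw [besselI, ← tsum_mul_left]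
  refine tsum_congr fun k => ?_
  have hpow : (x / 2) ^ (2 * (k : ℝ) + ν) = (x / 2) ^ ν * (x / 2) ^ (2 * k) := by
    rw [Real.rpow_add (by positivity), mul_comm, ← Real.rpow_natCast]
    push_cast
    rfl
  rw [hpow, mul_div_assoc, add_assoc]

lemma tendsto_tsum_bessel {a : ℝ} (ha : 0 < a) :
    Tendsto (fun x : ℝ =>
        ∑' k : ℕ, (x / 2) ^ (2 * k) / ((k.factorial : ℝ) * Real.Gamma ((k : ℝ) + a)))
      (nhdsWithin 0 (Set.Ioi 0)) (nhds (1 / Real.Gamma a)) := by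
  have hlim : ∑' k : ℕ, ((0 : ℝ) / 2) ^ (2 * k) /
      ((k.factorial : ℝ) * Real.Gamma ((k : ℝ) + a)) = 1 / Real.Gamma a := by
    rw [tsum_eq_single 0 fun k hk => by simp [hk]]
    simp
  rw [← hlim]
  refine tendsto_tsum_of_dominated_convergence (summable_inv_factorial_mul_Gamma ha)
    (fun k => ?_) ?_
  · refine Tendsto.mono_left (Continuous.tendsto ?_ 0) nhdsWithin_le_nhds
    fun_prop
  · filter_upwards [Ioo_mem_nhdsGT (show (0 : ℝ) < 2 by norm_num)] with x hx k
    have hΓ := Real.Gamma_pos_of_pos (show (0 : ℝ) < (k : ℝ) + a by positivity)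
    have hx0 : 0 ≤ x / 2 := by linarith [hx.1]
    rw [Real.norm_of_nonneg (by positivity)]
    gcongr
    exact pow_le_one₀ hx0 (by linarith [hx.2])

lemma tendsto_besselI_quotient {s : ℝ} (hs : s ∈ Set.Ioo (0 : ℝ) 1) :
    Tendsto (fun r : ℝ => (2 : ℝ) ^ (1 - 2 * s) * (Real.Gamma (1 - s) / Real.Gamma s) *
        r ^ (2 * s - 2) * besselI (1 - s) r / besselI (s - 1) r)
      (nhdsWithin 0 (Set.Ioi 0)) (nhds (1 / (2 * (1 - s)))) := by
  obtain ⟨hs0, hs1⟩ := hs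
  have hs2 : 0 < 1 - s := by linarith
  have hΓs := Real.Gamma_pos_of_pos hs0
  have hΓ1 := Real.Gamma_pos_of_pos hs2
  have hnum := tendsto_tsum_bessel (show 0 < 1 - s + 1 by linarith)
  have hden := tendsto_tsum_bessel (show 0 < s - 1 + 1 by linarith)
  have hs3 : s - 1 + 1 = s := by ring
  have hne : 1 / Real.Gamma (s - 1 + 1) ≠ 0 := by
    rw [hs3]
    positivity
  have key := (hnum.div hden hne).const_mul (1 / 2 * (Real.Gamma (1 - s) / Real.Gamma s))
  have hval : 1 / 2 * (Real.Gamma (1 - s) / Real.Gamma s) *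
      (1 / Real.Gamma (1 - s + 1) / (1 / Real.Gamma (s - 1 + 1))) = 1 / (2 * (1 - s)) := by
    rw [hs3, Real.Gamma_add_one hs2.ne']
    field_simp
  rw [hval] at key
  refine key.congr' ?_
  filter_upwards [self_mem_nhdsWithin] with r (hr : 0 < r)
  rw [besselI_eq_rpow_mul _ hr, besselI_eq_rpow_mul _ hr, mul_div_assoc, mul_div_mul_comm,
    ← Real.rpow_sub (by positivity)]
  have hpow : (2 : ℝ) ^ (1 - 2 * s) * r ^ (2 * s - 2) * (r / 2) ^ (1 - s - (s - 1)) = 1 / 2 := by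
    rw [Real.div_rpow hr.le (by norm_num), show 1 - s - (s - 1) = -(2 * s - 2) by ring,
      show 1 - 2 * s = -(2 * s - 2) + (-1 : ℝ) by ring, Real.rpow_add (by norm_num),
      Real.rpow_neg_one, Real.rpow_neg hr.le]
    have h1 : (0 : ℝ) < r ^ (2 * s - 2) := by positivity
    have h2 : (0 : ℝ) < 2 ^ (-(2 * s - 2)) := by positivity
    field_simp
  rw [← hpow, Pi.div_apply]
  ring

/-- First part of the asymptotics in Theorem 1.1: the symbol `S_s` behaves like the symbol
`|ξ|²` of the classical Laplacian at small frequencies, with explicit constant `1/(2(1-s))`. -/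
theorem stmt1 (n : ℕ) (hn : 1 ≤ n) (s : ℝ) (hs : s ∈ Set.Ioo (0 : ℝ) 1) :
    Tendsto (fun r : ℝ => (2 : ℝ) ^ (1 - 2 * s) * (Real.Gamma (1 - s) / Real.Gamma s) *
        r ^ (2 * s - 2) * besselI (1 - s) r / besselI (s - 1) r)
      (nhdsWithin 0 (Set.Ioi 0)) (nhds (1 / (2 * (1 - s)))) ∧
    Tendsto (fun ξ : EuclideanSpace ℝ (Fin n) => symbolS s ξ / ‖ξ‖ ^ 2)
      (nhdsWithin 0 {0}ᶜ) (nhds (1 / (2 * (1 - s)))) := by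
  refine ⟨tendsto_besselI_quotient hs,
    ((tendsto_besselI_quotient hs).comp tendsto_norm_nhdsNE_zero).congr' ?_⟩
  filter_upwards [self_mem_nhdsWithin] with ξ hξ
  have hξ0 : ξ ≠ 0 := hξ
  have hpos : 0 < ‖ξ‖ := norm_pos_iff.mpr hξ0
  simp only [Function.comp_apply, symbolS, Stilde, if_neg hξ0, Cs]
  rw [Real.rpow_sub hpos, Real.rpow_two]
  ring
end

section
/- For every s ∈ (0,1), I_{1−s}(r)/I_{s−1}(r) → 1 as r → +∞. Consequently S̃_s(ξ) → C_s = 2^{1−2s} Γ(1−s)/Γ(s) and S_s(ξ)/|ξ|^{2s} → C_s as |ξ| → +∞; in particular the symbol S_s behaves like the symbol |ξ|^{2s} of the fractional Laplacian (−Δ)^s for large frequencies (second part of the asymptotics in Theorem 1.1). -/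
open MeasureTheory Filter

/-- Wendel's inequality. -/
theorem Gamma_add_le_Gamma_mul_rpow {x a : ℝ} (hx : 0 < x) (ha : 0 < a) (ha1 : a < 1) :
    Real.Gamma (x + a) ≤ Real.Gamma x * x ^ a := by
  have h := Real.Gamma_mul_add_mul_le_rpow_Gamma_mul_rpow_Gamma hx (by linarith : 0 < x + 1)
    (sub_pos.2 ha1) ha (by ring)
  have hG := Real.Gamma_pos_of_pos hx
  rw [Real.Gamma_add_one hx.ne', Real.mul_rpow hx.le hG.le] at h
  have e : Real.Gamma x ^ (1 - a) * Real.Gamma x ^ a = Real.Gamma x := by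
    rw [← Real.rpow_add hG]; simp
  calc Real.Gamma (x + a) = Real.Gamma ((1 - a) * x + a * (x + 1)) := by ring_nf
    _ ≤ _ := h
    _ = Real.Gamma x ^ (1 - a) * Real.Gamma x ^ a * x ^ a := by ring
    _ = _ := by rw [e]

theorem rpow_mul_Gamma_le_Gamma_add_one {x a : ℝ} (hx : 0 < x) (ha : 0 < a) (ha1 : a < 1) :
    x ^ a * Real.Gamma (x + (1 - a)) ≤ Real.Gamma (x + 1) := by
  have h := Gamma_add_le_Gamma_mul_rpow hx (sub_pos.2 ha1) (by linarith)
  have e : x ^ a * x ^ (1 - a) = x := by rw [← Real.rpow_add hx]; simp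
  calc _ ≤ x ^ a * (Real.Gamma x * x ^ (1 - a)) := by gcongr
    _ = x ^ a * x ^ (1 - a) * Real.Gamma x := by ring
    _ = _ := by rw [e, Real.Gamma_add_one hx.ne']

theorem Gamma_div_Gamma_le_rpow {a : ℝ} (ha : 0 < a) (ha1 : a < 1) (k : ℕ) :
    Real.Gamma (k + a + 1) / Real.Gamma (k - a + 1) ≤ (((k : ℝ) + 1) * (k + 1 - a)) ^ a := by
  have hk : (0 : ℝ) ≤ k := k.cast_nonneg
  have h1 := Gamma_add_le_Gamma_mul_rpow (by linarith : (0 : ℝ) < k + 1) ha ha1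
  have h2 := Gamma_add_le_Gamma_mul_rpow (by linarith : (0 : ℝ) < k + 1 - a) ha ha1
  have hG : 0 < Real.Gamma (k - a + 1) := Real.Gamma_pos_of_pos (by linarith)
  rw [div_le_iff₀ hG, Real.mul_rpow (by linarith) (by linarith)]
  rw [sub_add_cancel, show (k : ℝ) + 1 - a = k - a + 1 by ring] at h2
  calc Real.Gamma (k + a + 1) = Real.Gamma (k + 1 + a) := by ring_nf
    _ ≤ _ := h1
    _ ≤ Real.Gamma (k - a + 1) * (k - a + 1) ^ a * (k + 1) ^ a := by gcongr
    _ = _ := by ring_nf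

theorem rpow_le_Gamma_div_Gamma {a : ℝ} (ha : 0 < a) (ha1 : a < 1) (k : ℕ) :
    ((k : ℝ) * (k + a)) ^ a ≤ Real.Gamma (k + a + 1) / Real.Gamma (k - a + 1) := by
  have hk0 : (0 : ℝ) ≤ k := k.cast_nonneg
  have hG : 0 < Real.Gamma (k - a + 1) := Real.Gamma_pos_of_pos (by linarith)
  have hG' : 0 < Real.Gamma (k + a + 1) := Real.Gamma_pos_of_pos (by linarith)
  rcases hk0.eq_or_lt with hk | hk
  · have e : ((k : ℝ) * (k + a)) ^ a = 0 := by rw [← hk, zero_mul, Real.zero_rpow ha.ne']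
    rw [e]
    exact (div_pos hG' hG).le
  have h1 := rpow_mul_Gamma_le_Gamma_add_one (by linarith : (0 : ℝ) < k + a) ha ha1
  have h2 := rpow_mul_Gamma_le_Gamma_add_one hk ha ha1
  rw [le_div_iff₀ hG, Real.mul_rpow (by linarith) (by linarith)]
  rw [show (k : ℝ) + a + (1 - a) = k + 1 by ring] at h1
  calc _ = (k + a) ^ a * (k ^ a * Real.Gamma (k + (1 - a))) := by ring_nf
    _ ≤ (k + a) ^ a * Real.Gamma (k + 1) := by gcongr
    _ ≤ _ := h1

theorem rpow_le_tangent {a y : ℝ} (ha : 0 < a) (ha1 : a < 1) (hy : 0 ≤ y) :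
    y ^ a ≤ 1 + a * (y - 1) := by
  have h := rpow_one_add_le_one_add_mul_self (s := y - 1) (by linarith) ha.le ha1.le
  rwa [add_sub_cancel] at h

theorem tangent_sub_sq_le_rpow {a y : ℝ} (ha : 0 < a) (ha1 : a < 1) (hy : 0 ≤ y) :
    1 + a * (y - 1) - (y - 1) ^ 2 ≤ y ^ a := by
  rcases hy.eq_or_lt with rfl | hy
  · rw [Real.zero_rpow ha.ne']; linarith
  have h := rpow_le_tangent (sub_pos.2 ha1) (by linarith) hy.le
  have hp : 0 < y ^ (1 - a) := by positivity
  have e : y ^ a * y ^ (1 - a) = y := by rw [← Real.rpow_add hy]; simp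
  have hd : 0 < 1 + (1 - a) * (y - 1) := by nlinarith
  have h2 : y / (1 + (1 - a) * (y - 1)) ≤ y ^ a := by
    rw [div_le_iff₀ hd]
    calc y = y ^ a * y ^ (1 - a) := e.symm
      _ ≤ _ := by gcongr
  refine le_trans ?_ h2
  rw [le_div_iff₀ hd]
  have : 0 ≤ (y - 1) ^ 2 * (a ^ 2 + (1 - a) * y) := by
    have := sub_pos.2 ha1
    positivity
  nlinarith

/-- The `k`-th term of the power series of `I_ν(2t)`. -/
noncomputable def besselTerm (ν t : ℝ) (k : ℕ) : ℝ :=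
  t ^ (2 * (k : ℝ) + ν) / ((k.factorial : ℝ) * Real.Gamma ((k : ℝ) + ν + 1))

theorem besselTerm_pos {ν t : ℝ} (hν : -1 < ν) (ht : 0 < t) (k : ℕ) : 0 < besselTerm ν t k := by
  have hk : (0 : ℝ) ≤ k := k.cast_nonneg
  have hG : 0 < Real.Gamma (k + ν + 1) := Real.Gamma_pos_of_pos (by linarith)
  unfold besselTerm
  positivity

theorem besselTerm_succ {ν t : ℝ} (hν : -1 < ν) (ht : 0 < t) (k : ℕ) :
    ((k + 1 : ℕ) : ℝ) * ((k + 1 : ℕ) + ν) * besselTerm ν t (k + 1) =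
      t ^ 2 * besselTerm ν t k := by
  have hk : (0 : ℝ) ≤ k := k.cast_nonneg
  have hp : (0 : ℝ) < k + ν + 1 := by linarith
  have hG : 0 < Real.Gamma (k + ν + 1) := Real.Gamma_pos_of_pos hp
  unfold besselTerm
  have e1 : t ^ (2 * ((k + 1 : ℕ) : ℝ) + ν) = t ^ 2 * t ^ (2 * (k : ℝ) + ν) := by
    rw [← Real.rpow_natCast t 2, ← Real.rpow_add ht]
    push_cast; ring_nf
  have e2 : Real.Gamma (((k + 1 : ℕ) : ℝ) + ν + 1) = (k + ν + 1) * Real.Gamma (k + ν + 1) := by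
    rw [← Real.Gamma_add_one hp.ne']
    push_cast; ring_nf
  rw [e1, e2, Nat.factorial_succ]
  push_cast
  rw [show (k : ℝ) + 1 + ν = k + ν + 1 by ring]
  have hf : (0 : ℝ) < k.factorial := by positivity
  field_simp

theorem summable_besselTerm {ν t : ℝ} (hν : -1 < ν) (ht : 0 < t) :
    Summable (besselTerm ν t) := by
  refine summable_of_ratio_test_tendsto_lt_one (l := 0) one_pos
    (Eventually.of_forall fun k => (besselTerm_pos hν ht k).ne') ?_
  have h1 : Tendsto (fun k : ℕ => ((k + 1 : ℕ) : ℝ)) atTop atTop :=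
    tendsto_natCast_atTop_atTop.comp (tendsto_add_atTop_nat 1)
  have h2 : Tendsto (fun k : ℕ => t ^ 2 / (((k + 1 : ℕ) : ℝ) * ((k + 1 : ℕ) + ν))) atTop
      (nhds 0) :=
    (h1.atTop_mul_atTop₀ (tendsto_atTop_add_const_right _ ν h1)).const_div_atTop _
  refine h2.congr fun k => ?_
  have hk : (0 : ℝ) ≤ k := k.cast_nonneg
  have hp : (0 : ℝ) < ((k + 1 : ℕ) : ℝ) * ((k + 1 : ℕ) + ν) := by
    push_cast
    exact mul_pos (by linarith) (by linarith)
  have hw := besselTerm_pos hν ht k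
  have hw' := besselTerm_pos hν ht (k + 1)
  rw [Real.norm_of_nonneg hw.le, Real.norm_of_nonneg hw'.le, div_eq_div_iff hp.ne' hw.ne',
    ← besselTerm_succ hν ht]
  ring

theorem besselTerm_neg {a t : ℝ} (ha : 0 < a) (ht : 0 < t) (k : ℕ) :
    besselTerm (-a) t k = besselTerm a t k *
      (Real.Gamma (k + a + 1) / Real.Gamma (k - a + 1) / (t ^ 2) ^ a) := by
  have hk : (0 : ℝ) ≤ k := k.cast_nonneg
  have hG : 0 < Real.Gamma (k + a + 1) := Real.Gamma_pos_of_pos (by linarith)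
  have e : t ^ (2 * (k : ℝ) + a) = t ^ (2 * (k : ℝ) + -a) * (t ^ 2) ^ a := by
    rw [← Real.rpow_natCast t 2, ← Real.rpow_mul ht.le, ← Real.rpow_add ht]
    push_cast; ring_nf
  have hp : 0 < (t ^ 2) ^ a := by positivity
  unfold besselTerm
  rw [e, ← sub_eq_add_neg (k : ℝ) a]
  field_simp

theorem besselTerm_neg_le {a t : ℝ} (ha : 0 < a) (ha1 : a < 1) (ht : 0 < t) (k : ℕ) :
    besselTerm (-a) t k ≤ besselTerm a t k *
      (1 + a * (((k : ℝ) + 1) * (k + 1 - a) / t ^ 2 - 1)) := by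
  have hk : (0 : ℝ) ≤ k := k.cast_nonneg
  have hw := besselTerm_pos (by linarith : -1 < a) ht k
  have hq : 0 ≤ ((k : ℝ) + 1) * (k + 1 - a) := mul_nonneg (by linarith) (by linarith)
  rw [besselTerm_neg ha ht]
  gcongr
  refine le_trans ?_ (rpow_le_tangent ha ha1 (div_nonneg hq (by positivity)))
  rw [Real.div_rpow hq (by positivity)]
  gcongr
  exact Gamma_div_Gamma_le_rpow ha ha1 k

theorem le_besselTerm_neg {a t : ℝ} (ha : 0 < a) (ha1 : a < 1) (ht : 0 < t) (k : ℕ) :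
    besselTerm a t k * (1 + a * ((k : ℝ) * (k + a) / t ^ 2 - 1) -
      ((k : ℝ) * (k + a) / t ^ 2 - 1) ^ 2) ≤ besselTerm (-a) t k := by
  have hk : (0 : ℝ) ≤ k := k.cast_nonneg
  have hw := besselTerm_pos (by linarith : -1 < a) ht k
  have hq : 0 ≤ (k : ℝ) * (k + a) := by positivity
  rw [besselTerm_neg ha ht]
  gcongr
  refine (tangent_sub_sq_le_rpow ha ha1 (div_nonneg hq (by positivity))).trans ?_
  rw [Real.div_rpow hq (by positivity)]
  gcongr
  exact rpow_le_Gamma_div_Gamma ha ha1 k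

/-- Summation form of `besselTerm_succ`. -/
theorem hasSum_mul_besselTerm {ν t c : ℝ} (hν : -1 < ν) (ht : 0 < t) {f : ℕ → ℝ}
    (hf : HasSum (fun k => f (k + 1) * besselTerm ν t k) c) :
    HasSum (fun k : ℕ => f k * ((k : ℝ) * (k + ν)) * besselTerm ν t k) (t ^ 2 * c) := by
  rw [← hasSum_nat_add_iff' 1]
  simp only [Finset.range_one, Finset.sum_singleton, Nat.cast_zero, zero_mul, mul_zero, sub_zero]
  refine (hf.mul_left (t ^ 2)).congr_fun fun k => ?_
  rw [mul_assoc, besselTerm_succ hν ht]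
  ring

theorem abs_tsum_besselTerm_neg_sub_le {a t : ℝ} (ha : 0 < a) (ha1 : a < 1) (ht : 0 < t) :
    |∑' k, besselTerm (-a) t k - ∑' k, besselTerm a t k| ≤
      (2 * t + 2) / t ^ 2 * ∑' k, besselTerm a t k := by
  have ha' : -1 < a := by linarith
  have hw := besselTerm_pos ha' ht
  have hb := (summable_besselTerm (by linarith : -1 < -a) ht).hasSum
  have h0 := (summable_besselTerm ha' ht).hasSum
  set w := besselTerm a t
  set S := ∑' k, w k
  set B := ∑' k, besselTerm (-a) t k
  have hS : 0 ≤ S := tsum_nonneg fun k => (hw k).le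
  have hq : HasSum (fun k : ℕ => (k : ℝ) * (k + a) * w k) (t ^ 2 * S) := by
    simpa using hasSum_mul_besselTerm (f := fun _ => 1) ha' ht (by simpa using h0)
  have hle : ∀ k : ℕ, (k : ℝ) * w k ≤ ((k : ℝ) * (k + a) * w k + t ^ 2 * w k) / (2 * t) := by
    intro k
    rw [le_div_iff₀ (by positivity)]
    have : 0 ≤ w k * (((k : ℝ) - t) ^ 2 + k * a) :=
      mul_nonneg (hw k).le (by positivity)
    nlinarith
  have hs := (hq.add (h0.mul_left (t ^ 2))).div_const (2 * t)
  have hm : Summable fun k : ℕ => (k : ℝ) * w k :=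
    Summable.of_nonneg_of_le (fun k => mul_nonneg k.cast_nonneg (hw k).le) hle hs.summable
  have h1 := hm.hasSum
  set m := ∑' k : ℕ, (k : ℝ) * w k
  have hmt : m ≤ t * S := by
    refine (hasSum_le hle h1 hs).trans_eq ?_
    field_simp; ring
  have hq2 : HasSum (fun k : ℕ => (k : ℝ) * (k + a) * ((k : ℝ) * (k + a)) * w k)
      (t ^ 2 * (t ^ 2 * S + 2 * m + (1 + a) * S)) := by
    refine hasSum_mul_besselTerm (f := fun k : ℕ => (k : ℝ) * (k + a)) ha' ht ?_
    refine ((hq.add (h1.mul_left 2)).add (h0.mul_left (1 + a))).congr_fun fun k => ?_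
    push_cast; ring
  have hup : B ≤ S + a * (2 * m + S) / t ^ 2 := by
    have hub : HasSum (fun k : ℕ => w k * (1 + a * (((k : ℝ) * (k + a) + (2 * k + 1)) / t ^ 2 - 1)))
        (S + a * (2 * m + S) / t ^ 2) := by
      have := ((h0.mul_left (1 - a)).add (hq.mul_left (a / t ^ 2))).add
        (((h1.mul_left 2).add h0).mul_left (a / t ^ 2))
      rw [show S + a * (2 * m + S) / t ^ 2 =
        (1 - a) * S + a / t ^ 2 * (t ^ 2 * S) + a / t ^ 2 * (2 * m + S) by field_simp; ring]
      exact this.congr_fun fun k => by field_simp; ring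
    refine hasSum_le (fun k => (besselTerm_neg_le ha ha1 ht k).trans ?_) hb hub
    have hk : (0 : ℝ) ≤ k := k.cast_nonneg
    refine mul_le_mul_of_nonneg_left ?_ (hw k).le
    gcongr
    nlinarith [mul_nonneg hk ha.le]
  have hlo : S - (2 * m + (1 + a) * S) / t ^ 2 ≤ B := by
    refine hasSum_le (fun k => le_besselTerm_neg ha ha1 ht k) ?_ hb
    have := ((h0.mul_left (-a)).add (hq.mul_left ((a + 2) / t ^ 2))).sub
      (hq2.mul_left (1 / t ^ 4))
    rw [show S - (2 * m + (1 + a) * S) / t ^ 2 = -a * S + (a + 2) / t ^ 2 * (t ^ 2 * S) -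
      1 / t ^ 4 * (t ^ 2 * (t ^ 2 * S + 2 * m + (1 + a) * S)) by field_simp; ring]
    exact this.congr_fun fun k => by field_simp; ring
  have hm0 : 0 ≤ m := tsum_nonneg fun k => mul_nonneg k.cast_nonneg (hw k).le
  have hb1 : a * (2 * m + S) / t ^ 2 ≤ (2 * t + 2) / t ^ 2 * S := by
    rw [div_mul_eq_mul_div]
    refine div_le_div_of_nonneg_right ?_ (by positivity)
    nlinarith [mul_nonneg (sub_nonneg.2 ha1.le) (by linarith : 0 ≤ 2 * m + S)]
  have hb2 : (2 * m + (1 + a) * S) / t ^ 2 ≤ (2 * t + 2) / t ^ 2 * S := by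
    rw [div_mul_eq_mul_div]
    refine div_le_div_of_nonneg_right ?_ (by positivity)
    nlinarith
  rw [abs_le]
  constructor <;> linarith

theorem tendsto_besselI_div_besselI_neg {a : ℝ} (ha : 0 < a) (ha1 : a < 1) :
    Tendsto (fun r : ℝ => besselI a r / besselI (-a) r) atTop (nhds 1) := by
  suffices h : Tendsto (fun r : ℝ => besselI (-a) r / besselI a r - 1) atTop (nhds 0) by
    have h' := (h.add_const 1).inv₀ (by simp)
    simpa using h'
  have hhalf : Tendsto (fun r : ℝ => r / 2) atTop atTop := tendsto_id.atTop_div_const two_pos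
  have hlim : Tendsto (fun t : ℝ => (2 * t + 2) / t ^ 2) atTop (nhds 0) := by
    have h1 := (tendsto_inv_atTop_zero (𝕜 := ℝ)).const_mul 2
    have h2 := ((tendsto_inv_atTop_zero (𝕜 := ℝ)).pow 2).const_mul 2
    have h3 := h1.add h2
    norm_num at h3
    refine h3.congr' ?_
    filter_upwards [eventually_gt_atTop 0] with t ht
    field_simp
  refine squeeze_zero_norm' ?_ (hlim.comp hhalf)
  filter_upwards [eventually_gt_atTop 0] with r hr
  have ht : 0 < r / 2 := by positivity
  have hA : 0 < besselI a r :=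
    (summable_besselTerm (by linarith : -1 < a) ht).tsum_pos
      (fun k => (besselTerm_pos (by linarith) ht k).le) 0 (besselTerm_pos (by linarith) ht 0)
  have h : |besselI (-a) r - besselI a r| ≤ _ := abs_tsum_besselTerm_neg_sub_le ha ha1 ht
  rw [Real.norm_eq_abs, div_sub_one hA.ne', abs_div, abs_of_pos hA, div_le_iff₀ hA]
  exact h

/-- Second part of the asymptotics in Theorem 1.1: the Bessel quotient tends to `1` at
infinity, so the symbol `S_s` behaves like the symbol `|ξ|^{2s}` of the fractional
Laplacian `(-Δ)^s` at large frequencies. -/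
theorem stmt2 (n : ℕ) (hn : 1 ≤ n) (s : ℝ) (hs : s ∈ Set.Ioo (0 : ℝ) 1) :
    Tendsto (fun r : ℝ => besselI (1 - s) r / besselI (s - 1) r) atTop (nhds 1) ∧
    Tendsto (fun ξ : EuclideanSpace ℝ (Fin n) => Stilde s ξ)
      (Filter.comap (fun ξ : EuclideanSpace ℝ (Fin n) => ‖ξ‖) atTop) (nhds (Cs s)) ∧
    Tendsto (fun ξ : EuclideanSpace ℝ (Fin n) => symbolS s ξ / ‖ξ‖ ^ (2 * s))
      (Filter.comap (fun ξ : EuclideanSpace ℝ (Fin n) => ‖ξ‖) atTop) (nhds (Cs s)) := by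
  have hpos : ∀ᶠ ξ : EuclideanSpace ℝ (Fin n) in
      Filter.comap (fun ξ : EuclideanSpace ℝ (Fin n) => ‖ξ‖) atTop, 0 < ‖ξ‖ :=
    tendsto_comap.eventually (eventually_gt_atTop 0)
  have h1 : Tendsto (fun r : ℝ => besselI (1 - s) r / besselI (s - 1) r) atTop (nhds 1) := by
    have h := tendsto_besselI_div_besselI_neg (sub_pos.2 hs.2) (by linarith [hs.1])
    rwa [neg_sub] at h
  have h2 : Tendsto (fun ξ : EuclideanSpace ℝ (Fin n) => Stilde s ξ)
      (Filter.comap (fun ξ : EuclideanSpace ℝ (Fin n) => ‖ξ‖) atTop) (nhds (Cs s)) := by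
    have h := (h1.comp (tendsto_comap (f := fun ξ : EuclideanSpace ℝ (Fin n) => ‖ξ‖))).const_mul
      (Cs s)
    rw [mul_one] at h
    refine h.congr' ?_
    filter_upwards [hpos] with ξ hξ
    rw [Stilde, if_neg (norm_pos_iff.1 hξ), Function.comp_apply, mul_div_assoc]
  refine ⟨h1, h2, h2.congr' ?_⟩
  filter_upwards [hpos] with ξ hξ
  rw [symbolS, mul_div_cancel_left₀ _ (Real.rpow_pos_of_pos hξ _).ne']
end

section
/- For every s ∈ (0,1), the function r ↦ I_{1−s}(r)/I_{s−1}(r) is strictly increasing on (0, +∞) and takes values in the open interval (0, 1). Consequently the symbol S_s is positive on ℝⁿ \ {0}, |ξ| ↦ S_s(ξ) is strictly increasing as a function of |ξ|, and S_s(ξ) ≤ C_s |ξ|^{2s} for every ξ (positivity and monotonicity of the symbol as asserted in Theorem 1.1). -/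
open MeasureTheory Filter

/-- The entire function `z ↦ ∑ zᵏ / (k! Γ(k + ν + 1))`, so that
`I_ν(x) = (x / 2) ^ ν * besselSeries ν ((x / 2) ^ 2)`. -/
noncomputable def besselSeries (ν z : ℝ) : ℝ :=
  ∑' k : ℕ, z ^ k / ((k.factorial : ℝ) * Real.Gamma ((k : ℝ) + ν + 1))

lemma gamma_nat_add_pos {ν : ℝ} (hν : -1 < ν) (k : ℕ) : 0 < Real.Gamma ((k : ℝ) + ν + 1) :=
  Real.Gamma_pos_of_pos (by have := k.cast_nonneg (α := ℝ); linarith)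

lemma exists_inv_gamma_le {ν : ℝ} (hν : -1 < ν) :
    ∃ C : ℝ, 0 < C ∧ ∀ k : ℕ, 1 / Real.Gamma ((k : ℝ) + ν + 1) ≤ C := by
  have h0 := gamma_nat_add_pos hν 0
  have h1 := gamma_nat_add_pos hν 1
  refine ⟨1 / Real.Gamma (((0 : ℕ) : ℝ) + ν + 1) + 1 / Real.Gamma (((1 : ℕ) : ℝ) + ν + 1),
    by positivity, fun k => ?_⟩
  have aux : ∀ k : ℕ, 1 / Real.Gamma (((k + 1 : ℕ) : ℝ) + ν + 1) ≤
      1 / Real.Gamma (((1 : ℕ) : ℝ) + ν + 1) := by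
    intro k
    induction k with
    | zero => simp
    | succ k ih =>
      refine le_trans ?_ ih
      have hk := gamma_nat_add_pos hν (k + 1)
      have e : Real.Gamma (((k + 1 + 1 : ℕ) : ℝ) + ν + 1) =
          (((k + 1 : ℕ) : ℝ) + ν + 1) * Real.Gamma (((k + 1 : ℕ) : ℝ) + ν + 1) := by
        rw [← Real.Gamma_add_one]
        · push_cast; ring_nf
        · have := k.cast_nonneg (α := ℝ); push_cast; linarith
      rw [e]
      apply one_div_le_one_div_of_le hk
      have := k.cast_nonneg (α := ℝ)
      apply le_mul_of_one_le_left hk.le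
      push_cast; linarith
  cases k with
  | zero => have : 0 ≤ 1 / Real.Gamma (((1 : ℕ) : ℝ) + ν + 1) := by positivity
            linarith
  | succ k => have : 0 ≤ 1 / Real.Gamma (((0 : ℕ) : ℝ) + ν + 1) := by positivity
              linarith [aux k]

lemma summable_besselSeries {ν : ℝ} (hν : -1 < ν) (z : ℝ) :
    Summable fun k : ℕ => z ^ k / ((k.factorial : ℝ) * Real.Gamma ((k : ℝ) + ν + 1)) := by
  obtain ⟨C, hC, h⟩ := exists_inv_gamma_le hν
  refine Summable.of_norm_bounded ((Real.summable_pow_div_factorial |z|).mul_right C) fun k => ?_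
  have hk := gamma_nat_add_pos hν k
  have : z ^ k / ((k.factorial : ℝ) * Real.Gamma ((k : ℝ) + ν + 1)) =
    z ^ k / k.factorial * (1 / Real.Gamma ((k : ℝ) + ν + 1)) := by field_simp
  rw [this, norm_mul, norm_div, norm_pow, Real.norm_eq_abs, Real.norm_of_nonneg (by positivity),
    Real.norm_of_nonneg (by positivity)]
  gcongr
  exact h k

lemma hasSum_besselSeries {ν : ℝ} (hν : -1 < ν) (z : ℝ) :
    HasSum (fun k : ℕ => z ^ k / ((k.factorial : ℝ) * Real.Gamma ((k : ℝ) + ν + 1)))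
      (besselSeries ν z) :=
  (summable_besselSeries hν z).hasSum

lemma besselSeries_pos {ν : ℝ} (hν : -1 < ν) {z : ℝ} (hz : 0 ≤ z) : 0 < besselSeries ν z := by
  refine (summable_besselSeries hν z).tsum_pos (fun k => ?_) 0 ?_
  · have := gamma_nat_add_pos hν k
    positivity
  · have := gamma_nat_add_pos hν 0
    simp only [pow_zero, Nat.factorial_zero]
    positivity

lemma hasSum_deriv_besselSeries {ν : ℝ} (hν : -1 < ν) (z : ℝ) :
    HasSum (fun k : ℕ => ((k : ℝ) * z ^ (k - 1)) /
      ((k.factorial : ℝ) * Real.Gamma ((k : ℝ) + ν + 1))) (besselSeries (ν + 1) z) := by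
  rw [← hasSum_nat_add_iff' 1]
  simp only [Finset.range_one, Finset.sum_singleton, Nat.cast_zero, zero_mul, zero_div, sub_zero]
  refine Eq.mp (congrArg (HasSum · _) (funext fun k => ?_))
    (hasSum_besselSeries (ν := ν + 1) (by linarith) z)
  symm
  rw [Nat.factorial_succ, add_tsub_cancel_right]
  push_cast
  have : (k : ℝ) + 1 ≠ 0 := by positivity
  rw [show (k : ℝ) + (ν + 1) + 1 = k + 1 + ν + 1 by ring, mul_assoc, mul_div_mul_left _ _ this]

lemma hasDerivAt_besselSeries {ν : ℝ} (hν : -1 < ν) (z : ℝ) :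
    HasDerivAt (besselSeries ν) (besselSeries (ν + 1) z) z := by
  obtain ⟨C, hC, h⟩ := exists_inv_gamma_le hν
  set R : ℝ := |z| + 1
  have hR : 0 < R := by positivity
  have hu : Summable fun k : ℕ => ((k : ℝ) * R ^ (k - 1)) / k.factorial * C := by
    apply Summable.mul_right
    rw [← summable_nat_add_iff 1]
    refine (Real.summable_pow_div_factorial R).congr fun k => ?_
    rw [Nat.factorial_succ, add_tsub_cancel_right]
    push_cast
    rw [mul_div_mul_left _ _ (by positivity)]
  have key := hasDerivAt_tsum_of_isPreconnected (𝕜 := ℝ)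
    (g := fun (k : ℕ) (w : ℝ) => w ^ k / ((k.factorial : ℝ) * Real.Gamma ((k : ℝ) + ν + 1)))
    (g' := fun (k : ℕ) (w : ℝ) => ((k : ℝ) * w ^ (k - 1)) /
      ((k.factorial : ℝ) * Real.Gamma ((k : ℝ) + ν + 1)))
    (t := Metric.ball (0 : ℝ) R) (y₀ := z) (y := z) hu Metric.isOpen_ball
    (convex_ball (0 : ℝ) R).isPreconnected
    (fun k w _ => (hasDerivAt_pow k w).div_const _) ?_ ?_ (summable_besselSeries hν z) ?_
  · rw [(hasSum_deriv_besselSeries hν z).tsum_eq] at key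
    exact key
  · intro k w hw
    have hw' : |w| ≤ R := by simpa using (Metric.mem_ball.1 hw).le
    have hk := gamma_nat_add_pos hν k
    have e : (k : ℝ) * w ^ (k - 1) / ((k.factorial : ℝ) * Real.Gamma ((k : ℝ) + ν + 1)) =
      (k : ℝ) * w ^ (k - 1) / k.factorial * (1 / Real.Gamma ((k : ℝ) + ν + 1)) := by field_simp
    rw [e, norm_mul, norm_div, norm_mul, norm_pow, Real.norm_eq_abs w,
      Real.norm_of_nonneg (by positivity), Real.norm_of_nonneg (by positivity),
      Real.norm_of_nonneg (by positivity)]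
    gcongr
    exact h k
  · simp [R]
  · simp [R]

lemma besselSeries_recurrence {ν : ℝ} (hν : -1 < ν) (z : ℝ) :
    besselSeries ν z = (ν + 1) * besselSeries (ν + 1) z + z * besselSeries (ν + 2) z := by
  have h1 : -1 < ν + 1 := by linarith
  have h2 := ((hasSum_besselSeries h1 z).mul_left (ν + 1)).add
    ((hasSum_deriv_besselSeries h1 z).mul_left z)
  rw [show ν + 1 + 1 = ν + 2 by ring] at h2
  refine (hasSum_besselSeries hν z).unique
    (Eq.mp (congrArg (HasSum · _) (funext fun k => ?_)) h2)
  symm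
  have hk := gamma_nat_add_pos hν k
  have hp : 0 < (k : ℝ) + ν + 1 := by have := k.cast_nonneg (α := ℝ); linarith
  have e : Real.Gamma ((k : ℝ) + (ν + 1) + 1) = (k + ν + 1) * Real.Gamma (k + ν + 1) := by
    rw [← Real.Gamma_add_one hp.ne']; ring_nf
  have e2 : z * ((k : ℝ) * z ^ (k - 1)) = k * z ^ k := by
    cases k with
    | zero => simp
    | succ k => rw [add_tsub_cancel_right, pow_succ]; ring
  rw [e, ← mul_div_assoc, ← mul_div_assoc, e2, ← add_div]
  field_simp
  ring

lemma besselSeries_zero_right (ν : ℝ) : besselSeries ν 0 = 1 / Real.Gamma (ν + 1) := by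
  unfold besselSeries
  rw [tsum_eq_single 0]
  · simp
  · intro k hk
    simp [hk]

lemma besselSeries_wronskian {a : ℝ} (ha : a ∈ Set.Ioo (0 : ℝ) 1) (z : ℝ) :
    besselSeries (a - 1) z * besselSeries (-a) z - z * (besselSeries a z * besselSeries (1 - a) z) =
      1 / (Real.Gamma a * Real.Gamma (1 - a)) := by
  obtain ⟨h0, h1⟩ := ha
  set G : ℝ → ℝ := fun z => besselSeries (a - 1) z * besselSeries (-a) z -
    z * (besselSeries a z * besselSeries (1 - a) z) with hG
  have hd : ∀ z, HasDerivAt G 0 z := by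
    intro z
    have d1 := hasDerivAt_besselSeries (ν := a - 1) (by linarith) z
    have d2 := hasDerivAt_besselSeries (ν := -a) (by linarith) z
    have d3 := hasDerivAt_besselSeries (ν := a) (by linarith) z
    have d4 := hasDerivAt_besselSeries (ν := 1 - a) (by linarith) z
    have r1 := besselSeries_recurrence (ν := a - 1) (by linarith) z
    have r2 := besselSeries_recurrence (ν := -a) (by linarith) z
    rw [show a - 1 + 1 = a by ring] at d1 r1
    rw [show -a + 1 = 1 - a by ring] at d2 r2
    rw [show a - 1 + 2 = a + 1 by ring] at r1
    rw [show -a + 2 = 1 - a + 1 by ring] at r2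
    refine ((d1.mul d2).sub ((hasDerivAt_id z).mul (d3.mul d4))).congr_deriv ?_
    simp only [id, Pi.mul_apply]
    linear_combination besselSeries (1 - a) z * r1 + besselSeries a z * r2
  have hc := is_const_of_deriv_eq_zero (fun z => (hd z).differentiableAt) (fun z => (hd z).deriv) z 0
  change G z = _
  rw [hc]
  simp only [hG, besselSeries_zero_right, zero_mul, sub_zero, sub_add_cancel]
  rw [show -a + 1 = 1 - a by ring]
  field_simp

lemma strictMonoOn_rpow_mul_besselSeries_div {a : ℝ} (ha : a ∈ Set.Ioo (0 : ℝ) 1) :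
    StrictMonoOn (fun z => z ^ a * besselSeries a z / besselSeries (-a) z) (Set.Ioi 0) := by
  have hW := besselSeries_wronskian ha
  obtain ⟨h0, h1⟩ := ha
  have hd : ∀ z ∈ Set.Ioi (0 : ℝ), HasDerivAt
      (fun z => z ^ a * besselSeries a z / besselSeries (-a) z)
      (z ^ (a - 1) * (1 / (Real.Gamma a * Real.Gamma (1 - a))) / besselSeries (-a) z ^ 2) z := by
    intro z hz
    have hz : 0 < z := hz
    have d2 := hasDerivAt_besselSeries (ν := -a) (by linarith) z
    have d3 := hasDerivAt_besselSeries (ν := a) (by linarith) z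
    have r1 := besselSeries_recurrence (ν := a - 1) (by linarith) z
    rw [show a - 1 + 1 = a by ring, show a - 1 + 2 = a + 1 by ring] at r1
    rw [show -a + 1 = 1 - a by ring] at d2
    have hF := besselSeries_pos (ν := -a) (by linarith) hz.le
    have dp := Real.hasDerivAt_rpow_const (x := z) (p := a) (Or.inl hz.ne')
    refine ((dp.mul d3).div d2 hF.ne').congr_deriv ?_
    have e : z ^ a = z ^ (a - 1) * z := by
      rw [← Real.rpow_add_one hz.ne', sub_add_cancel]
    congr 1
    rw [← hW z, r1]
    simp only [Pi.mul_apply]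
    rw [e]
    ring
  refine strictMonoOn_of_deriv_pos (convex_Ioi 0)
    (fun z hz => (hd z hz).continuousAt.continuousWithinAt) fun z hz => ?_
  rw [interior_Ioi] at hz
  rw [(hd z hz).deriv]
  have hz' : 0 < z := hz
  have := besselSeries_pos (ν := -a) (by linarith) hz'.le
  have := Real.Gamma_pos_of_pos h0
  have := Real.Gamma_pos_of_pos (show 0 < 1 - a by linarith)
  positivity

lemma rpow_div_gamma_le {a y : ℝ} (ha : a ∈ Set.Ioo (0 : ℝ) 1) (hy : 0 < y) (k : ℕ) :
    y ^ a / Real.Gamma (k + a + 1) ≤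
      a * y / Real.Gamma (k + 1 + 1) +
        (1 - a) * (1 / Real.Gamma (k + 0 + 1) + 1 / Real.Gamma (k + 1 + 1)) := by
  obtain ⟨h0, h1⟩ := ha
  have hk : (0 : ℝ) ≤ k := k.cast_nonneg
  have hp : 0 < (k : ℝ) + a + 1 := by positivity
  have hΓ := Real.Gamma_pos_of_pos hp
  have hΓ0 := Real.Gamma_pos_of_pos (show 0 < (k : ℝ) + 1 by positivity)
  have c := Real.Gamma_mul_add_mul_le_rpow_Gamma_mul_rpow_Gamma hp
    (show 0 < (k : ℝ) + a + 1 + 1 by positivity) h0 (show 0 < 1 - a by linarith) (by ring)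
  rw [show a * ((k : ℝ) + a + 1) + (1 - a) * (k + a + 1 + 1) = k + 1 + 1 by ring,
    Real.Gamma_add_one hp.ne', Real.mul_rpow hp.le hΓ.le] at c
  have e : Real.Gamma (k + a + 1) ^ a * ((k + a + 1) ^ (1 - a) * Real.Gamma (k + a + 1) ^ (1 - a)) =
      (k + a + 1) ^ (1 - a) * Real.Gamma (k + a + 1) := by
    rw [mul_left_comm, ← Real.rpow_add hΓ, add_sub_cancel, Real.rpow_one]
  rw [e] at c
  have am := Real.geom_mean_le_arith_mean2_weighted h0.le (show 0 ≤ 1 - a by linarith) hy.le hp.le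
    (by ring)
  have hk1 : (k : ℝ) + 1 ≠ 0 := by positivity
  rw [add_zero, Real.Gamma_add_one hk1] at *
  have main : y ^ a * ((k + 1) * Real.Gamma (k + 1)) ≤
      (a * y + (1 - a) * (k + 1 + 1)) * Real.Gamma (k + a + 1) := by
    calc y ^ a * ((k + 1) * Real.Gamma (k + 1))
        ≤ y ^ a * ((k + a + 1) ^ (1 - a) * Real.Gamma (k + a + 1)) := by gcongr
      _ = (y ^ a * (k + a + 1) ^ (1 - a)) * Real.Gamma (k + a + 1) := by ring
      _ ≤ (a * y + (1 - a) * (k + a + 1)) * Real.Gamma (k + a + 1) := by gcongr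
      _ ≤ _ := by
        have : 0 ≤ 1 - a := by linarith
        gcongr
  have rhs : a * y / ((k + 1) * Real.Gamma (k + 1)) +
        (1 - a) * (1 / Real.Gamma (k + 1) + 1 / ((k + 1) * Real.Gamma (k + 1))) =
      (a * y + (1 - a) * (k + 1 + 1)) / ((k + 1) * Real.Gamma (k + 1)) := by
    field_simp
  rw [rhs, div_le_div_iff₀ hΓ (by positivity)]
  exact main

lemma le_rpow_neg_div_gamma {a y : ℝ} (ha : a ∈ Set.Ioo (0 : ℝ) 1) (hy : 0 < y) (k : ℕ) :
    (1 + a) / Real.Gamma (k + 0 + 1) - (a * y + a / (1 - a)) / Real.Gamma (k + 1 + 1) ≤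
      y ^ (-a) / Real.Gamma (k + -a + 1) := by
  obtain ⟨h0, h1⟩ := ha
  have hk : (0 : ℝ) ≤ k := k.cast_nonneg
  have h1a : 0 < 1 - a := by linarith
  have hp : 0 < (k : ℝ) + 1 := by positivity
  have hpa : 0 < (k : ℝ) + -a + 1 := by linarith
  have hΓ0 := Real.Gamma_pos_of_pos hp
  have hΓ := Real.Gamma_pos_of_pos hpa
  have c := Real.Gamma_mul_add_mul_le_rpow_Gamma_mul_rpow_Gamma hp
    (show 0 < (k : ℝ) + 1 + 1 by positivity) h0 h1a (by ring)
  rw [show a * ((k : ℝ) + 1) + (1 - a) * (k + 1 + 1) = k + -a + 1 + 1 by ring,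
    Real.Gamma_add_one hpa.ne', Real.Gamma_add_one hp.ne'] at c
  have am := Real.geom_mean_le_arith_mean2_weighted h0.le h1a.le
    (show 0 ≤ y * Real.Gamma (k + 1) by positivity)
    (show 0 ≤ ((k : ℝ) + 1) * Real.Gamma (k + 1) by positivity) (by ring)
  rw [Real.mul_rpow hy.le hΓ0.le] at am
  have ya : 0 < y ^ a := by positivity
  set D := a * y + (1 - a) * (k + 1) with hD
  have hDpos : 0 < D := by positivity
  have upper : y ^ a * ((k + -a + 1) * Real.Gamma (k + -a + 1)) ≤ D * Real.Gamma (k + 1) := by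
    calc _ ≤ y ^ a * (Real.Gamma (k + 1) ^ a * ((k + 1) * Real.Gamma (k + 1)) ^ (1 - a)) := by
          gcongr
      _ ≤ _ := by rw [← mul_assoc]; exact am.trans_eq (by ring)
  have lower : (k + -a + 1) / (D * Real.Gamma (k + 1)) ≤ y ^ (-a) / Real.Gamma (k + -a + 1) := by
    rw [Real.rpow_neg hy.le, ← one_div, div_div, div_le_div_iff₀ (by positivity) (by positivity)]
    linarith
  refine le_trans ?_ lower
  rw [add_zero, Real.Gamma_add_one hp.ne']
  have e : (1 + a) / Real.Gamma (k + 1) - (a * y + a / (1 - a)) / ((k + 1) * Real.Gamma (k + 1)) =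
      ((1 + a) * (k + 1) - (a * y + a / (1 - a))) / (k + 1) / Real.Gamma (k + 1) := by
    field_simp
  rw [e, ← div_div]
  refine div_le_div_of_nonneg_right ?_ hΓ0.le
  rw [div_le_div_iff₀ hp hDpos]
  have hc : a / (1 - a) * D ≥ a * (k + 1) := by
    have : a / (1 - a) * D = a * (k + 1) + a / (1 - a) * (a * y) := by
      rw [hD]; field_simp; ring
    rw [this]
    have : 0 ≤ a / (1 - a) * (a * y) := by positivity
    linarith
  nlinarith [sq_nonneg (a * (y - (k + 1)))]

lemma mul_besselSeries_one_le (y : ℝ) :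
    y * besselSeries 1 (y ^ 2) ≤ besselSeries 0 (y ^ 2) := by
  have s0 := hasSum_besselSeries (ν := 0) (by norm_num) (y ^ 2)
  have s1 := (hasSum_besselSeries (ν := 1) (by norm_num) (y ^ 2)).mul_left y
  have s2 := (hasSum_nat_add_iff' 1).2 s0
  have s3 := (s0.add s2).mul_left (1 / 2)
  refine (hasSum_le (fun k => ?_) s1 s3).trans ?_
  · have e : Real.Gamma ((k : ℝ) + 0 + 1) = k.factorial := by
      rw [add_zero, Real.Gamma_nat_eq_factorial]
    have e1 : Real.Gamma (((k : ℕ) : ℝ) + 1 + 1) = (k + 1).factorial := by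
      rw [← Real.Gamma_nat_eq_factorial]; push_cast; rfl
    have e2 : Real.Gamma (((k + 1 : ℕ) : ℝ) + 0 + 1) = (k + 1).factorial := by
      rw [add_zero, Real.Gamma_nat_eq_factorial]
    rw [e, e1, e2]
    have p1 : 0 < (k.factorial : ℝ) := by positivity
    have p2 : 0 < ((k + 1).factorial : ℝ) := by positivity
    have := sq_nonneg (y ^ k / (k.factorial : ℝ) - y ^ (k + 1) / (k + 1).factorial)
    have q1 : y * ((y ^ 2) ^ k / ((k.factorial : ℝ) * (k + 1).factorial)) =
      y ^ k / (k.factorial : ℝ) * (y ^ (k + 1) / (k + 1).factorial) := by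
      field_simp
      ring
    have q2 : (y ^ 2) ^ k / ((k.factorial : ℝ) * k.factorial) = (y ^ k / (k.factorial : ℝ)) ^ 2 := by
      rw [div_pow, ← pow_mul, ← pow_mul, mul_comm 2 k, pow_two (k.factorial : ℝ)]
    have q3 : (y ^ 2) ^ (k + 1) / (((k + 1).factorial : ℝ) * (k + 1).factorial) =
      (y ^ (k + 1) / ((k + 1).factorial : ℝ)) ^ 2 := by
      rw [div_pow, ← pow_mul, ← pow_mul, mul_comm 2 (k + 1), pow_two ((k + 1).factorial : ℝ)]
    rw [q1, q2, q3]
    linarith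
  · simp
    linarith

lemma rpow_mul_besselSeries_le {a y : ℝ} (ha : a ∈ Set.Ioo (0 : ℝ) 1) (hy : 0 < y) :
    y ^ a * besselSeries a (y ^ 2) ≤ besselSeries 0 (y ^ 2) * (1 + (1 - a) / y) := by
  have s0 := hasSum_besselSeries (ν := 0) (by norm_num) (y ^ 2)
  have s1 := hasSum_besselSeries (ν := 1) (by norm_num) (y ^ 2)
  have sa := hasSum_besselSeries (ν := a) (by linarith [ha.1]) (y ^ 2)
  have hle := hasSum_le (fun k => ?_) (sa.mul_left (y ^ a))
    ((s1.mul_left (a * y)).add ((s0.add s1).mul_left (1 - a)))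
  · have hB := mul_besselSeries_one_le y
    have h1 : 0 < 1 - a := by linarith [ha.2]
    have hB' : besselSeries 1 (y ^ 2) ≤ besselSeries 0 (y ^ 2) / y := by
      rw [le_div_iff₀ hy]; linarith
    have i1 := mul_le_mul_of_nonneg_left hB ha.1.le
    have i2 := mul_le_mul_of_nonneg_left hB' h1.le
    have : besselSeries 0 (y ^ 2) * (1 + (1 - a) / y) =
      besselSeries 0 (y ^ 2) + (1 - a) * (besselSeries 0 (y ^ 2) / y) := by ring
    linarith
  · have := mul_le_mul_of_nonneg_left (rpow_div_gamma_le ha hy k)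
      (show 0 ≤ (y ^ 2) ^ k / (k.factorial : ℝ) by positivity)
    convert this using 1
    · simp only [div_eq_mul_inv, mul_inv]; ring
    · simp only [div_eq_mul_inv, mul_inv]; ring

lemma le_rpow_neg_mul_besselSeries {a y : ℝ} (ha : a ∈ Set.Ioo (0 : ℝ) 1) (hy : 0 < y) :
    besselSeries 0 (y ^ 2) * (1 - a / (1 - a) / y) ≤ y ^ (-a) * besselSeries (-a) (y ^ 2) := by
  have s0 := hasSum_besselSeries (ν := 0) (by norm_num) (y ^ 2)
  have s1 := hasSum_besselSeries (ν := 1) (by norm_num) (y ^ 2)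
  have sa := hasSum_besselSeries (ν := -a) (by linarith [ha.2]) (y ^ 2)
  have hle := hasSum_le (fun k => ?_) ((s0.mul_left (1 + a)).sub (s1.mul_left (a * y + a / (1 - a))))
    (sa.mul_left (y ^ (-a)))
  · have hB := mul_besselSeries_one_le y
    have h1 : 0 < 1 - a := by linarith [ha.2]
    have hB' : besselSeries 1 (y ^ 2) ≤ besselSeries 0 (y ^ 2) / y := by
      rw [le_div_iff₀ hy]; linarith
    have i1 := mul_le_mul_of_nonneg_left hB ha.1.le
    have i2 := mul_le_mul_of_nonneg_left hB' (show 0 ≤ a / (1 - a) from div_nonneg ha.1.le h1.le)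
    have : besselSeries 0 (y ^ 2) * (1 - a / (1 - a) / y) =
      besselSeries 0 (y ^ 2) - a / (1 - a) * (besselSeries 0 (y ^ 2) / y) := by ring
    linarith
  · have := mul_le_mul_of_nonneg_left (le_rpow_neg_div_gamma ha hy k)
      (show 0 ≤ (y ^ 2) ^ k / (k.factorial : ℝ) by positivity)
    convert this using 1
    · simp only [div_eq_mul_inv, mul_inv]; ring
    · simp only [div_eq_mul_inv, mul_inv]; ring

lemma besselI_eq (ν : ℝ) {x : ℝ} (hx : 0 < x) :
    besselI ν x = (x / 2) ^ ν * besselSeries ν ((x / 2) ^ 2) := by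
  have h : 0 < x / 2 := by positivity
  unfold besselI besselSeries
  rw [← tsum_mul_left]
  refine tsum_congr fun k => ?_
  rw [Real.rpow_add h, Real.rpow_mul h.le, Real.rpow_two, Real.rpow_natCast]
  ring

lemma besselI_pos {ν x : ℝ} (hν : -1 < ν) (hx : 0 < x) : 0 < besselI ν x := by
  rw [besselI_eq ν hx]
  have := besselSeries_pos hν (sq_nonneg (x / 2))
  positivity

lemma strictMonoOn_besselI_div {a : ℝ} (ha : a ∈ Set.Ioo (0 : ℝ) 1) :
    StrictMonoOn (fun r => besselI a r / besselI (-a) r) (Set.Ioi 0) := by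
  have e : ∀ r : ℝ, 0 < r → besselI a r / besselI (-a) r =
      ((r / 2) ^ 2) ^ a * besselSeries a ((r / 2) ^ 2) / besselSeries (-a) ((r / 2) ^ 2) := by
    intro r hr
    have h : 0 < r / 2 := by positivity
    rw [besselI_eq a hr, besselI_eq (-a) hr, Real.rpow_neg h.le]
    have e2 : ((r / 2) ^ 2) ^ a = (r / 2) ^ a * (r / 2) ^ a := by
      rw [pow_two, Real.mul_rpow h.le h.le]
    rw [e2]
    have : (r / 2) ^ a ≠ 0 := by positivity
    have := (besselSeries_pos (ν := -a) (by linarith [ha.2]) (sq_nonneg (r / 2))).ne'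
    field_simp
  intro r hr t ht hrt
  have hr : 0 < r := hr
  have ht : 0 < t := ht
  simp only [e r hr, e t ht]
  exact strictMonoOn_rpow_mul_besselSeries_div ha (Set.mem_Ioi.2 (by positivity))
    (Set.mem_Ioi.2 (by positivity)) (by gcongr)

lemma besselI_div_lt_one {a : ℝ} (ha : a ∈ Set.Ioo (0 : ℝ) 1) {r : ℝ} (hr : 0 < r) :
    besselI a r / besselI (-a) r < 1 := by
  have hmono := strictMonoOn_besselI_div ha
  have hlt := hmono (Set.mem_Ioi.2 hr) (Set.mem_Ioi.2 (show 0 < r + 1 by linarith))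
    (by linarith : r < r + 1)
  refine lt_of_lt_of_le hlt ?_
  have hlim : Tendsto (fun t : ℝ => (1 + (1 - a) / (t / 2)) / (1 - a / (1 - a) / (t / 2))) atTop
      (nhds ((1 + 0) / (1 - 0))) := by
    have ht : Tendsto (fun t : ℝ => t / 2) atTop atTop := tendsto_id.atTop_div_const (by norm_num)
    exact (tendsto_const_nhds.add (ht.const_div_atTop _)).div
      (tendsto_const_nhds.sub (ht.const_div_atTop _)) (by norm_num)
  have h1 : 0 < 1 - a := by linarith [ha.2]
  have hc : 0 < a / (1 - a) := div_pos ha.1 h1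
  rw [show ((1 : ℝ) + 0) / (1 - 0) = 1 by norm_num] at hlim
  refine ge_of_tendsto hlim ?_
  filter_upwards [eventually_ge_atTop (r + 1), eventually_gt_atTop (2 * (a / (1 - a)))] with t h2 h3
  have ht : 0 < t := by linarith
  have hy : 0 < t / 2 := by positivity
  refine (hmono.monotoneOn (Set.mem_Ioi.2 (show 0 < r + 1 by linarith)) (Set.mem_Ioi.2 ht) h2).trans
    ?_
  have hA := besselSeries_pos (ν := 0) (by norm_num) (sq_nonneg (t / 2))
  have hd : 0 < 1 - a / (1 - a) / (t / 2) := by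
    rw [sub_pos, div_lt_one hy]; linarith
  have up := rpow_mul_besselSeries_le ha hy
  have lo := le_rpow_neg_mul_besselSeries ha hy
  rw [← besselI_eq _ ht] at up lo
  calc besselI a t / besselI (-a) t
      ≤ (besselSeries 0 ((t / 2) ^ 2) * (1 + (1 - a) / (t / 2))) /
        (besselSeries 0 ((t / 2) ^ 2) * (1 - a / (1 - a) / (t / 2))) := by
        gcongr
    _ = _ := mul_div_mul_left _ _ hA.ne'

lemma Cs_pos {s : ℝ} (hs : s ∈ Set.Ioo (0 : ℝ) 1) : 0 < Cs s := by
  have := Real.Gamma_pos_of_pos hs.1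
  have := Real.Gamma_pos_of_pos (show 0 < 1 - s by linarith [hs.2])
  unfold Cs
  positivity

lemma symbolS_of_ne_zero {n : ℕ} (s : ℝ) {ξ : EuclideanSpace ℝ (Fin n)} (hξ : ξ ≠ 0) :
    symbolS s ξ = Cs s * ‖ξ‖ ^ (2 * s) * (besselI (1 - s) ‖ξ‖ / besselI (s - 1) ‖ξ‖) := by
  rw [symbolS, Stilde, if_neg hξ]
  ring

lemma symbolS_zero {n : ℕ} (s : ℝ) : symbolS s (0 : EuclideanSpace ℝ (Fin n)) = 0 := by
  simp [symbolS, Stilde]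

/-- Positivity and monotonicity of the symbol, as asserted in Theorem 1.1: the Bessel
quotient is strictly increasing on `(0,∞)` with values in `(0,1)`; consequently the symbol
`S_s` is positive away from the origin, strictly increasing in `|ξ|`, and bounded above by
`C_s |ξ|^{2s}`. -/
theorem stmt3 (n : ℕ) (hn : 1 ≤ n) (s : ℝ) (hs : s ∈ Set.Ioo (0 : ℝ) 1) :
    StrictMonoOn (fun r : ℝ => besselI (1 - s) r / besselI (s - 1) r) (Set.Ioi 0) ∧
    (∀ r : ℝ, 0 < r → besselI (1 - s) r / besselI (s - 1) r ∈ Set.Ioo (0 : ℝ) 1) ∧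
    (∀ ξ : EuclideanSpace ℝ (Fin n), ξ ≠ 0 → 0 < symbolS s ξ) ∧
    (∀ ξ₁ ξ₂ : EuclideanSpace ℝ (Fin n), ‖ξ₁‖ < ‖ξ₂‖ → symbolS s ξ₁ < symbolS s ξ₂) ∧
    (∀ ξ : EuclideanSpace ℝ (Fin n), symbolS s ξ ≤ Cs s * ‖ξ‖ ^ (2 * s)) := by
  have ha : 1 - s ∈ Set.Ioo (0 : ℝ) 1 := ⟨by linarith [hs.2], by linarith [hs.1]⟩
  have hneg : s - 1 = -(1 - s) := by ring
  have hmono : StrictMonoOn (fun r : ℝ => besselI (1 - s) r / besselI (s - 1) r) (Set.Ioi 0) := by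
    rw [hneg]
    exact strictMonoOn_besselI_div ha
  have hmem : ∀ r : ℝ, 0 < r → besselI (1 - s) r / besselI (s - 1) r ∈ Set.Ioo (0 : ℝ) 1 := by
    intro r hr
    refine ⟨div_pos (besselI_pos (by linarith [hs.2]) hr) (besselI_pos (by linarith [hs.1]) hr), ?_⟩
    rw [hneg]
    exact besselI_div_lt_one ha hr
  have hC := Cs_pos hs
  have hpos : ∀ ξ : EuclideanSpace ℝ (Fin n), ξ ≠ 0 → 0 < symbolS s ξ := by
    intro ξ hξ
    have hξ' := norm_pos_iff.2 hξ
    have := (hmem _ hξ').1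
    rw [symbolS_of_ne_zero s hξ]
    positivity
  refine ⟨hmono, hmem, hpos, fun ξ₁ ξ₂ h => ?_, fun ξ => ?_⟩
  · have h₂ : 0 < ‖ξ₂‖ := (norm_nonneg _).trans_lt h
    have hξ₂ := norm_pos_iff.1 h₂
    rcases eq_or_ne ξ₁ 0 with rfl | hξ₁
    · rw [symbolS_zero]
      exact hpos _ hξ₂
    · have h₁ := norm_pos_iff.2 hξ₁
      rw [symbolS_of_ne_zero s hξ₁, symbolS_of_ne_zero s hξ₂]
      have hs0 := hs.1
      refine mul_lt_mul'' ?_ (hmono h₁ h₂ h) (by positivity) (hmem _ h₁).1.le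
      gcongr
  · rcases eq_or_ne ξ 0 with rfl | hξ
    · rw [symbolS_zero]
      positivity
    · rw [symbolS_of_ne_zero s hξ]
      exact mul_le_of_le_one_right (by positivity) (hmem _ (norm_pos_iff.2 hξ)).2.le
end

section
/- For every s ∈ (0,1) and every p > 0, the integral ∫₀^{+∞} t^p / I_{s−1}(t)² dt is finite (the integrand is continuous and positive on (0,∞), bounded near t = 0, and decays faster than every power of t as t → +∞). -/
open MeasureTheory Filter

theorem besselI_term_pos {s x : ℝ} (hs : 0 < s) (hx : 0 < x) (k : ℕ) :
    0 < (x / 2) ^ (2 * (k : ℝ) + (s - 1)) /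
      ((k.factorial : ℝ) * Real.Gamma ((k : ℝ) + (s - 1) + 1)) := by
  have : 0 < Real.Gamma ((k : ℝ) + (s - 1) + 1) :=
    Real.Gamma_pos_of_pos (by have := k.cast_nonneg (α := ℝ); linarith)
  positivity

theorem mul_Gamma_le_Gamma_natCast_add {s : ℝ} (hs : s ∈ Set.Ioo (0 : ℝ) 1) (k : ℕ) :
    s * Real.Gamma s ≤ Real.Gamma (k + s) := by
  have hG := Real.Gamma_pos_of_pos hs.1
  rcases k with _ | k
  · simpa using mul_le_of_le_one_left hG.le hs.2.le
  · induction k with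
    | zero => rw [← Real.Gamma_add_one hs.1.ne']; simp [add_comm]
    | succ k ih =>
      have h1 : (1 : ℝ) ≤ ((k + 1 : ℕ) : ℝ) + s := by
        push_cast
        linarith [hs.1, k.cast_nonneg (α := ℝ)]
      have h2 : ((k + 1 + 1 : ℕ) : ℝ) + s = ((k + 1 : ℕ) : ℝ) + s + 1 := by
        push_cast
        ring
      rw [h2, Real.Gamma_add_one (by linarith)]
      exact ih.trans (le_mul_of_one_le_left (Real.Gamma_pos_of_pos (by linarith)).le h1)

theorem summable_besselI_term {s x : ℝ} (hs : s ∈ Set.Ioo (0 : ℝ) 1) (hx : 0 < x) :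
    Summable fun k : ℕ => (x / 2) ^ (2 * (k : ℝ) + (s - 1)) /
      ((k.factorial : ℝ) * Real.Gamma ((k : ℝ) + (s - 1) + 1)) := by
  have hG := Real.Gamma_pos_of_pos hs.1
  have hs0 := hs.1
  refine Summable.of_nonneg_of_le (fun k => (besselI_term_pos hs.1 hx k).le) (fun k => ?_)
    ((Real.summable_pow_div_factorial ((x / 2) ^ 2)).mul_left
      ((x / 2) ^ (s - 1) / (s * Real.Gamma s)))
  have hpow : (x / 2) ^ (2 * (k : ℝ) + (s - 1)) = (x / 2) ^ (s - 1) * ((x / 2) ^ 2) ^ k := by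
    rw [Real.rpow_add (by positivity), ← pow_mul, ← Real.rpow_natCast (x / 2) (2 * k)]
    push_cast
    ring
  rw [hpow, show (k : ℝ) + (s - 1) + 1 = k + s by ring, div_mul_div_comm, mul_comm (s * _)]
  gcongr
  exact mul_Gamma_le_Gamma_natCast_add hs k

theorem aemeasurable_besselI {s : ℝ} (hs : s ∈ Set.Ioo (0 : ℝ) 1) :
    AEMeasurable (besselI (s - 1)) (volume.restrict (Set.Ioi 0)) := by
  refine aemeasurable_of_tendsto_metrizable_ae (atTop : Filter ℕ)
    (f := fun n x => ∑ k ∈ Finset.range n, (x / 2) ^ (2 * (k : ℝ) + (s - 1)) /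
      ((k.factorial : ℝ) * Real.Gamma ((k : ℝ) + (s - 1) + 1)))
    (fun n => Measurable.aemeasurable (by fun_prop)) ?_
  filter_upwards [ae_restrict_mem measurableSet_Ioi] with x hx
  exact (summable_besselI_term hs hx).hasSum.tendsto_sum_nat

/-- Each term of the series gives a power-type lower bound for `besselI (s - 1)`. -/
theorem exists_mul_rpow_le_besselI {s : ℝ} (hs : s ∈ Set.Ioo (0 : ℝ) 1) (k : ℕ) :
    ∃ c > 0, ∀ x > 0, c * x ^ (2 * (k : ℝ) + (s - 1)) ≤ besselI (s - 1) x := by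
  refine ⟨_, besselI_term_pos hs.1 one_pos k, fun x hx => ?_⟩
  refine le_of_eq_of_le ?_ ((summable_besselI_term hs hx).le_tsum k
    fun j _ => (besselI_term_pos hs.1 hx j).le)
  rw [div_mul_eq_mul_div, ← Real.mul_rpow (by norm_num) hx.le, one_div_mul_eq_div]

/-- Each term of the series gives a power-type upper bound for `t ^ p / besselI (s - 1) t ^ 2`. -/
theorem integrableOn_rpow_div_besselI_sq {s p : ℝ} (hs : s ∈ Set.Ioo (0 : ℝ) 1) (k : ℕ)
    {S : Set ℝ} (hS : MeasurableSet S) (hS0 : S ⊆ Set.Ioi 0)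
    (hint : IntegrableOn (fun t : ℝ => t ^ (p - 2 * (2 * (k : ℝ) + (s - 1)))) S) :
    IntegrableOn (fun t : ℝ => t ^ p / (besselI (s - 1) t) ^ 2) S := by
  obtain ⟨c, hc, hle⟩ := exists_mul_rpow_le_besselI hs k
  refine Integrable.mono' (hint.const_mul (1 / c ^ 2)) ?_ ?_
  · have h := (aemeasurable_besselI hs).mono_measure (Measure.restrict_mono_set volume hS0)
    exact AEMeasurable.aestronglyMeasurable (by fun_prop)
  · filter_upwards [ae_restrict_mem hS] with t ht
    have ht0 : 0 < t := hS0 ht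
    rw [Real.norm_of_nonneg (by positivity), Real.rpow_sub ht0, mul_comm 2 (_ + _),
      Real.rpow_mul ht0.le, Real.rpow_two, div_mul_div_comm, one_mul, ← mul_pow]
    gcongr
    exact hle t ht0

/-- For every `s ∈ (0,1)` and `p > 0`, the integral `∫₀^∞ t^p / I_{s-1}(t)² dt` is finite. -/
theorem stmt5 (s : ℝ) (hs : s ∈ Set.Ioo (0 : ℝ) 1) (p : ℝ) (hp : 0 < p) :
    IntegrableOn (fun t : ℝ => t ^ p / (besselI (s - 1) t) ^ 2) (Set.Ioi 0) := by
  rw [← Set.Ioc_union_Ioi_eq_Ioi zero_le_one]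
  refine IntegrableOn.union ?_ ?_
  · refine integrableOn_rpow_div_besselI_sq hs 0 measurableSet_Ioc (fun t ht => ht.1) ?_
    rw [← intervalIntegrable_iff_integrableOn_Ioc_of_le zero_le_one]
    refine intervalIntegral.intervalIntegrable_rpow' ?_
    push_cast
    linarith [hs.2]
  · obtain ⟨k, hk⟩ := exists_nat_gt (p + 3)
    refine integrableOn_rpow_div_besselI_sq hs k measurableSet_Ioi
      (Set.Ioi_subset_Ioi zero_le_one) ?_
    exact integrableOn_Ioi_rpow_of_lt (by linarith [hs.1]) one_pos
end

section
/- (Proposition 1.4, behavior at infinity) Let s ∈ (0,1/2) and define, in dimension n = 1, T_s(r) := ∫_ℝ S_s(ξ) · 4 sin²(rξ)/ξ² dξ for r > 0. Then T_s(r) → 2 ∫_ℝ S̃_s(ξ) |ξ|^{2s−2} dξ as r → +∞, and this limit is a finite positive constant depending only on s. In particular, T_s interpolates the fractional and the classical perimeter in dimension one: it converges to a constant for large r, counting the fixed number of discontinuities of the indicator of an interval. -/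
open MeasureTheory Filter

open Classical in
/-- The rescaled symbol `S̃_s` in dimension one. -/
noncomputable def Stilde1 (s ξ : ℝ) : ℝ :=
  if ξ = 0 then 0 else Cs s * besselI (1 - s) |ξ| / besselI (s - 1) |ξ|

/-- The Dirichlet-to-Neumann symbol `S_s(ξ) = |ξ|^{2s} S̃_s(ξ)` in dimension one. -/
noncomputable def symbolS1 (s ξ : ℝ) : ℝ := |ξ| ^ (2 * s) * Stilde1 s ξ

/-- `T_s(r) = ∫_ℝ S_s(ξ) · 4 sin²(rξ)/ξ² dξ`, the value of the limit functional on the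
indicator of an interval of length `2r`. -/
noncomputable def Ts (s r : ℝ) : ℝ :=
  ∫ ξ : ℝ, symbolS1 s ξ * (4 * (Real.sin (r * ξ)) ^ 2 / ξ ^ 2)

/-- The general term of the power series defining `besselI`. -/
noncomputable def besselITerm (ν x : ℝ) (k : ℕ) : ℝ :=
  (x / 2) ^ (2 * (k : ℝ) + ν) / ((k.factorial : ℝ) * Real.Gamma ((k : ℝ) + ν + 1))

lemma besselI_eq_tsum (ν x : ℝ) : besselI ν x = ∑' k, besselITerm ν x k := rfl

lemma besselITerm_pos {ν x : ℝ} (hν : -1 < ν) (hx : 0 < x) (k : ℕ) : 0 < besselITerm ν x k := by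
  have hk : (0 : ℝ) ≤ k := k.cast_nonneg
  have hΓ : 0 < Real.Gamma ((k : ℝ) + ν + 1) := Real.Gamma_pos_of_pos (by linarith)
  unfold besselITerm
  positivity

lemma besselITerm_succ {ν x : ℝ} (hν : -1 < ν) (hx : 0 < x) (k : ℕ) :
    besselITerm ν x (k + 1) =
      besselITerm ν x k * ((x / 2) ^ 2 / (((k : ℝ) + 1) * ((k : ℝ) + ν + 1))) := by
  have hk : (0 : ℝ) ≤ k := k.cast_nonneg
  have hν' : 0 < (k : ℝ) + ν + 1 := by linarith
  have hΓ : 0 < Real.Gamma ((k : ℝ) + ν + 1) := Real.Gamma_pos_of_pos hν'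
  have hpow : (x / 2) ^ (2 * ((k + 1 : ℕ) : ℝ) + ν) =
      (x / 2) ^ (2 * (k : ℝ) + ν) * (x / 2) ^ 2 := by
    rw [← Real.rpow_natCast (x / 2) 2, ← Real.rpow_add (by positivity)]
    congr 1
    push_cast
    ring
  have hGamma : Real.Gamma (((k + 1 : ℕ) : ℝ) + ν + 1) =
      ((k : ℝ) + ν + 1) * Real.Gamma ((k : ℝ) + ν + 1) := by
    rw [← Real.Gamma_add_one hν'.ne']
    congr 1
    push_cast
    ring
  unfold besselITerm
  rw [hpow, hGamma, Nat.factorial_succ]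
  push_cast
  field_simp

lemma summable_besselITerm {ν x : ℝ} (hν : -1 < ν) (hx : 0 < x) :
    Summable (besselITerm ν x) := by
  refine summable_of_ratio_test_tendsto_lt_one zero_lt_one
    (Eventually.of_forall fun k => (besselITerm_pos hν hx k).ne') ?_
  have hratio : ∀ k : ℕ, ‖besselITerm ν x (k + 1)‖ / ‖besselITerm ν x k‖ =
      (x / 2) ^ 2 / (((k : ℝ) + 1) * ((k : ℝ) + ν + 1)) := fun k => by
    rw [Real.norm_of_nonneg (besselITerm_pos hν hx _).le,
      Real.norm_of_nonneg (besselITerm_pos hν hx _).le, besselITerm_succ hν hx,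
      mul_div_cancel_left₀ _ (besselITerm_pos hν hx k).ne']
  simp_rw [hratio]
  refine Tendsto.div_atTop tendsto_const_nhds (Tendsto.atTop_mul_atTop₀ ?_ ?_)
  · exact tendsto_atTop_add_const_right _ _ tendsto_natCast_atTop_atTop
  · exact tendsto_atTop_add_const_right _ _
      (tendsto_atTop_add_const_right _ _ tendsto_natCast_atTop_atTop)

lemma measurable_besselI (ν : ℝ) : Measurable (besselI ν) := by
  unfold besselI
  exact Measurable.tsum fun k => by fun_prop

/-- Lower form of Gautschi's inequality. -/
lemma mul_Gamma_le_rpow_mul_Gamma_add {y ν : ℝ} (hy : 0 < y) (h0 : 0 < ν) (h1 : ν < 1) :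
    y * Real.Gamma y ≤ (y + ν) ^ (1 - ν) * Real.Gamma (y + ν) := by
  have hΓ : 0 < Real.Gamma (y + ν) := Real.Gamma_pos_of_pos (by linarith)
  have h := Real.Gamma_mul_add_mul_le_rpow_Gamma_mul_rpow_Gamma (s := y + ν) (t := y + ν + 1)
    (by linarith) (by linarith) h0 (sub_pos.2 h1) (by ring)
  rw [show ν * (y + ν) + (1 - ν) * (y + ν + 1) = y + 1 by ring, Real.Gamma_add_one hy.ne',
    Real.Gamma_add_one (by linarith),
    Real.mul_rpow (by linarith) hΓ.le] at h
  calc y * Real.Gamma y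
      ≤ (y + ν) ^ (1 - ν) * (Real.Gamma (y + ν) ^ ν * Real.Gamma (y + ν) ^ (1 - ν)) := by
        linarith
    _ = _ := by rw [← Real.rpow_add hΓ, add_sub_cancel, Real.rpow_one]

lemma Gamma_mul_rpow_le {ν : ℝ} (h0 : 0 < ν) (h1 : ν < 1) {t : ℝ} (ht : 0 ≤ t) :
    Real.Gamma (t + -ν + 1) * ((t + 1) * (t + -ν + 1)) ^ ν ≤
      2 / (1 - ν) * Real.Gamma (t + ν + 1) := by
  have hν : 0 < 1 - ν := sub_pos.2 h1
  set y := t + -ν + 1 with hy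
  have hy0 : 0 < y := by linarith
  have hz0 : 0 < t + 1 := by linarith
  have hΓ : 0 < Real.Gamma (t + ν + 1) := Real.Gamma_pos_of_pos (by linarith)
  have e1 := mul_Gamma_le_rpow_mul_Gamma_add hy0 h0 h1
  have e2 := mul_Gamma_le_rpow_mul_Gamma_add hz0 h0 h1
  rw [show y + ν = t + 1 by rw [hy]; ring] at e1
  rw [show t + 1 + ν = t + ν + 1 by ring] at e2
  have hC : 1 ≤ 2 / (1 - ν) := by rw [le_div_iff₀ hν]; linarith
  have hle : t + ν + 1 ≤ 2 / (1 - ν) * y := by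
    rw [div_mul_eq_mul_div, le_div_iff₀ hν, hy]
    nlinarith [sq_nonneg (1 - ν), mul_nonneg ht h0.le]
  have e3 : (t + ν + 1) ^ (1 - ν) ≤ 2 / (1 - ν) * y ^ (1 - ν) := calc
    (t + ν + 1) ^ (1 - ν) ≤ (2 / (1 - ν) * y) ^ (1 - ν) :=
        Real.rpow_le_rpow (by linarith) hle hν.le
    _ = (2 / (1 - ν)) ^ (1 - ν) * y ^ (1 - ν) := Real.mul_rpow (by linarith) hy0.le
    _ ≤ 2 / (1 - ν) * y ^ (1 - ν) := by
        gcongr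
        exact Real.rpow_le_self_of_one_le hC (by linarith)
  have hsplit : ∀ {a : ℝ}, 0 < a → a ^ ν * a ^ (1 - ν) = a := fun ha => by
    rw [← Real.rpow_add ha, add_sub_cancel, Real.rpow_one]
  have hyp : 0 < y ^ (1 - ν) := Real.rpow_pos_of_pos hy0 _
  refine le_of_mul_le_mul_right ?_ hyp
  calc Real.Gamma y * ((t + 1) * y) ^ ν * y ^ (1 - ν)
      = (t + 1) ^ ν * (Real.Gamma y * (y ^ ν * y ^ (1 - ν))) := by
        rw [Real.mul_rpow hz0.le hy0.le]; ring
    _ = (t + 1) ^ ν * (y * Real.Gamma y) := by rw [hsplit hy0]; ring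
    _ ≤ (t + 1) ^ ν * ((t + 1) ^ (1 - ν) * Real.Gamma (t + 1)) := by gcongr
    _ = (t + 1) * Real.Gamma (t + 1) := by rw [← mul_assoc, hsplit hz0]
    _ ≤ (t + ν + 1) ^ (1 - ν) * Real.Gamma (t + ν + 1) := e2
    _ ≤ 2 / (1 - ν) * y ^ (1 - ν) * Real.Gamma (t + ν + 1) := by gcongr
    _ = _ := by ring

lemma Gamma_sub_le_Gamma_add {ν : ℝ} (h0 : 0 < ν) (h1 : ν < 1) (k : ℕ) :
    Real.Gamma ((k : ℝ) + -ν + 1) ≤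
      Real.Gamma (1 - ν) / Real.Gamma (1 + ν) * Real.Gamma ((k : ℝ) + ν + 1) := by
  have hm : 0 < Real.Gamma (1 - ν) := Real.Gamma_pos_of_pos (by linarith)
  have hp : 0 < Real.Gamma (1 + ν) := Real.Gamma_pos_of_pos (by linarith)
  induction k with
  | zero =>
    rw [show ((0 : ℕ) : ℝ) + -ν + 1 = 1 - ν by simp; ring,
      show ((0 : ℕ) : ℝ) + ν + 1 = 1 + ν by simp; ring, div_mul_cancel₀ _ hp.ne']
  | succ k ih =>
    have hk : (0 : ℝ) ≤ k := k.cast_nonneg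
    have hm' : 0 < (k : ℝ) + -ν + 1 := by linarith
    have hp' : 0 < (k : ℝ) + ν + 1 := by linarith
    have hΓ := Real.Gamma_pos_of_pos hm'
    rw [show ((k + 1 : ℕ) : ℝ) + -ν + 1 = ((k : ℝ) + -ν + 1) + 1 by push_cast; ring,
      show ((k + 1 : ℕ) : ℝ) + ν + 1 = ((k : ℝ) + ν + 1) + 1 by push_cast; ring,
      Real.Gamma_add_one hm'.ne', Real.Gamma_add_one hp'.ne']
    calc ((k : ℝ) + -ν + 1) * Real.Gamma ((k : ℝ) + -ν + 1)
        ≤ ((k : ℝ) + ν + 1) *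
          (Real.Gamma (1 - ν) / Real.Gamma (1 + ν) * Real.Gamma ((k : ℝ) + ν + 1)) := by
          gcongr
          linarith
      _ = _ := by ring

lemma besselITerm_eq_neg {ν x : ℝ} (h1 : ν < 1) (hx : 0 < x) (k : ℕ) :
    besselITerm ν x k = besselITerm (-ν) x k * ((x / 2) ^ (2 * ν) *
      (Real.Gamma ((k : ℝ) + -ν + 1) / Real.Gamma ((k : ℝ) + ν + 1))) := by
  have hk : (0 : ℝ) ≤ k := k.cast_nonneg
  have hΓ : 0 < Real.Gamma ((k : ℝ) + -ν + 1) := Real.Gamma_pos_of_pos (by linarith)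
  unfold besselITerm
  rw [show 2 * (k : ℝ) + ν = 2 * (k : ℝ) + -ν + 2 * ν by ring, Real.rpow_add (by positivity)]
  field_simp

lemma besselI_le_rpow_mul_besselI_neg {ν x : ℝ} (h0 : 0 < ν) (h1 : ν < 1) (hx : 0 < x) :
    besselI ν x ≤
      (x / 2) ^ (2 * ν) * (Real.Gamma (1 - ν) / Real.Gamma (1 + ν)) * besselI (-ν) x := by
  have hsum := summable_besselITerm (ν := -ν) (by linarith) hx
  rw [besselI_eq_tsum, besselI_eq_tsum, ← tsum_mul_left]
  refine Summable.tsum_le_tsum (fun k => ?_) (summable_besselITerm (by linarith) hx)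
    (hsum.mul_left _)
  have hk : (0 : ℝ) ≤ k := k.cast_nonneg
  have hΓ : 0 < Real.Gamma ((k : ℝ) + ν + 1) := Real.Gamma_pos_of_pos (by linarith)
  have ht := besselITerm_pos (ν := -ν) (by linarith) hx k
  rw [besselITerm_eq_neg h1 hx, mul_comm]
  gcongr _ * ?_ * _
  rw [div_le_iff₀ hΓ]
  exact Gamma_sub_le_Gamma_add h0 h1 k

lemma besselITerm_le_add {ν x : ℝ} (h0 : 0 < ν) (h1 : ν < 1) (hx : 0 < x) (k : ℕ) :
    besselITerm ν x k ≤
      2 / (1 - ν) * (besselITerm (-ν) x k + besselITerm (-ν) x (k + 1)) := by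
  have hν : 0 < 1 - ν := sub_pos.2 h1
  have hk : (0 : ℝ) ≤ k := k.cast_nonneg
  have hΓ : 0 < Real.Gamma ((k : ℝ) + ν + 1) := Real.Gamma_pos_of_pos (by linarith)
  have hy : 0 < (k : ℝ) + -ν + 1 := by linarith
  have ht := besselITerm_pos (ν := -ν) (by linarith) hx k
  rw [besselITerm_succ (by linarith) hx, besselITerm_eq_neg h1 hx]
  set d := ((k : ℝ) + 1) * ((k : ℝ) + -ν + 1) with hd
  have hd0 : 0 < d := by positivity
  have hdν : 0 < d ^ ν := Real.rpow_pos_of_pos hd0 _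
  have hq : (x / 2) ^ (2 * ν) = ((x / 2) ^ 2 / d) ^ ν * d ^ ν := by
    rw [← Real.mul_rpow (by positivity) hd0.le, div_mul_cancel₀ _ hd0.ne',
      Real.rpow_mul (by positivity), Real.rpow_two]
  have hyoung : ((x / 2) ^ 2 / d) ^ ν ≤ 1 + (x / 2) ^ 2 / d := by
    have hq0 : 0 ≤ (x / 2) ^ 2 / d := by positivity
    have h := Real.geom_mean_le_arith_mean2_weighted hν.le h0.le zero_le_one hq0 (by ring)
    rw [Real.one_rpow, one_mul] at h
    nlinarith
  have hG : d ^ ν * (Real.Gamma ((k : ℝ) + -ν + 1) / Real.Gamma ((k : ℝ) + ν + 1)) ≤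
      2 / (1 - ν) := by
    rw [mul_div_assoc', div_le_iff₀ hΓ, mul_comm (d ^ ν)]
    exact Gamma_mul_rpow_le h0 h1 hk
  calc _ = besselITerm (-ν) x k * (((x / 2) ^ 2 / d) ^ ν *
        (d ^ ν * (Real.Gamma ((k : ℝ) + -ν + 1) / Real.Gamma ((k : ℝ) + ν + 1)))) := by
        rw [hq]; ring
    _ ≤ besselITerm (-ν) x k * ((1 + (x / 2) ^ 2 / d) * (2 / (1 - ν))) := by gcongr
    _ = _ := by ring

lemma besselI_le_const_mul_besselI_neg {ν x : ℝ} (h0 : 0 < ν) (h1 : ν < 1) (hx : 0 < x) :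
    besselI ν x ≤ 4 / (1 - ν) * besselI (-ν) x := by
  have hν : 0 < 1 - ν := sub_pos.2 h1
  have hsum := summable_besselITerm (ν := -ν) (by linarith) hx
  have hsucc := (summable_nat_add_iff 1).2 hsum
  have hle : ∑' k, besselITerm (-ν) x (k + 1) ≤ ∑' k, besselITerm (-ν) x k := by
    rw [hsum.tsum_eq_zero_add]
    linarith [besselITerm_pos (ν := -ν) (by linarith) hx 0]
  calc besselI ν x
      ≤ ∑' k, 2 / (1 - ν) * (besselITerm (-ν) x k + besselITerm (-ν) x (k + 1)) :=
        Summable.tsum_le_tsum (besselITerm_le_add h0 h1 hx)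
          (summable_besselITerm (by linarith) hx) ((hsum.add hsucc).mul_left _)
    _ = 2 / (1 - ν) * (∑' k, besselITerm (-ν) x k + ∑' k, besselITerm (-ν) x (k + 1)) := by
        rw [tsum_mul_left, hsum.tsum_add hsucc]
    _ ≤ 2 / (1 - ν) * (∑' k, besselITerm (-ν) x k + ∑' k, besselITerm (-ν) x k) := by gcongr
    _ = 4 / (1 - ν) * besselI (-ν) x := by rw [besselI_eq_tsum]; ring

lemma Cs_pos_s14 {s : ℝ} (h0 : 0 < s) (h1 : s < 1) : 0 < Cs s := by
  have := Real.Gamma_pos_of_pos h0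
  have := Real.Gamma_pos_of_pos (sub_pos.2 h1)
  unfold Cs
  positivity

lemma Stilde1_pos {s ξ : ℝ} (h0 : 0 < s) (h1 : s < 1) (hξ : ξ ≠ 0) : 0 < Stilde1 s ξ := by
  rw [Stilde1, if_neg hξ]
  exact div_pos (mul_pos (Cs_pos_s14 h0 h1) (besselI_pos (by linarith) (abs_pos.2 hξ)))
    (besselI_pos (by linarith) (abs_pos.2 hξ))

lemma Stilde1_nonneg {s : ℝ} (h0 : 0 < s) (h1 : s < 1) (ξ : ℝ) : 0 ≤ Stilde1 s ξ := by
  rcases eq_or_ne ξ 0 with rfl | hξ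
  · simp [Stilde1]
  · exact (Stilde1_pos h0 h1 hξ).le

lemma measurable_Stilde1 (s : ℝ) : Measurable (Stilde1 s) := by
  have hI := fun ν => (measurable_besselI ν).comp measurable_id.abs
  exact Measurable.ite (measurableSet_singleton 0) measurable_const
    (((hI (1 - s)).const_mul _).div (hI (s - 1)))

lemma Stilde1_le_const {s : ℝ} (h0 : 0 < s) (h1 : s < 1) (ξ : ℝ) :
    Stilde1 s ξ ≤ Cs s * (4 / s) := by
  have hC := Cs_pos_s14 h0 h1
  rcases eq_or_ne ξ 0 with rfl | hξ
  · rw [Stilde1, if_pos rfl]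
    positivity
  · have h := besselI_le_const_mul_besselI_neg (sub_pos.2 h1) (by linarith) (abs_pos.2 hξ)
    rw [neg_sub, sub_sub_cancel] at h
    rw [Stilde1, if_neg hξ, div_le_iff₀ (besselI_pos (by linarith) (abs_pos.2 hξ)), mul_assoc]
    gcongr

lemma exists_Stilde1_le_mul_rpow {s : ℝ} (h0 : 0 < s) (h1 : s < 1) :
    ∃ A, ∀ ξ, Stilde1 s ξ ≤ A * |ξ| ^ (2 - 2 * s) := by
  have hC := Cs_pos_s14 h0 h1
  have hm : 0 < Real.Gamma (1 - (1 - s)) := Real.Gamma_pos_of_pos (by linarith)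
  have hp : 0 < Real.Gamma (1 + (1 - s)) := Real.Gamma_pos_of_pos (by linarith)
  refine ⟨Cs s * (Real.Gamma (1 - (1 - s)) / Real.Gamma (1 + (1 - s))), fun ξ => ?_⟩
  rcases eq_or_ne ξ 0 with rfl | hξ
  · rw [Stilde1, if_pos rfl]
    positivity
  · have hξ' := abs_pos.2 hξ
    have h := besselI_le_rpow_mul_besselI_neg (sub_pos.2 h1) (by linarith) hξ'
    have hI : 0 < besselI (s - 1) |ξ| := besselI_pos (by linarith) hξ'
    rw [neg_sub] at h
    rw [Stilde1, if_neg hξ, div_le_iff₀ hI]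
    have hpow : (|ξ| / 2) ^ (2 * (1 - s)) ≤ |ξ| ^ (2 - 2 * s) := by
      rw [mul_sub, mul_one]
      exact Real.rpow_le_rpow (by positivity) (by linarith) (by linarith)
    calc Cs s * besselI (1 - s) |ξ|
        ≤ Cs s * ((|ξ| / 2) ^ (2 * (1 - s)) *
          (Real.Gamma (1 - (1 - s)) / Real.Gamma (1 + (1 - s))) * besselI (s - 1) |ξ|) := by
          gcongr
      _ ≤ Cs s * (|ξ| ^ (2 - 2 * s) *
          (Real.Gamma (1 - (1 - s)) / Real.Gamma (1 + (1 - s))) * besselI (s - 1) |ξ|) := by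
          gcongr
      _ = _ := by ring

lemma integrable_Stilde1_mul_rpow {s : ℝ} (h0 : 0 < s) (h1 : s < 1 / 2) :
    Integrable (fun ξ : ℝ => Stilde1 s ξ * |ξ| ^ (2 * s - 2)) := by
  obtain ⟨A, hA⟩ := exists_Stilde1_le_mul_rpow h0 (by linarith)
  set B := Cs s * (4 / s)
  have hAB : 0 ≤ max A B :=
    le_max_of_le_right (mul_nonneg (Cs_pos_s14 h0 (by linarith)).le (by positivity))
  have hdom : Integrable (fun ξ : ℝ => max A B * 4 * (1 + ‖ξ‖) ^ (-(2 - 2 * s))) :=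
    (integrable_one_add_norm (by simp; linarith)).const_mul _
  refine hdom.mono' ?_ ?_
  · exact ((measurable_Stilde1 s).mul
      (measurable_id.abs.pow_const _)).aestronglyMeasurable
  · filter_upwards [Measure.ae_ne volume (0 : ℝ)] with ξ hξ
    have hξ' := abs_pos.2 hξ
    rw [Real.norm_of_nonneg
      (mul_nonneg (Stilde1_nonneg h0 (by linarith) ξ) (by positivity)), neg_sub, Real.norm_eq_abs]
    have h4 : (1 : ℝ) ≤ 4 * 2 ^ (2 * s - 2) := by
      rw [show (4 : ℝ) = 2 ^ (2 : ℝ) by norm_num, ← Real.rpow_add two_pos]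
      exact Real.one_le_rpow one_le_two (by linarith)
    rcases le_total |ξ| 1 with hle | hle
    · calc Stilde1 s ξ * |ξ| ^ (2 * s - 2)
          ≤ A * |ξ| ^ (2 - 2 * s) * |ξ| ^ (2 * s - 2) := by gcongr; exact hA ξ
        _ = A := by
          rw [mul_assoc, ← Real.rpow_add hξ']
          simp
        _ ≤ max A B * 1 := by simp
        _ ≤ max A B * (4 * 2 ^ (2 * s - 2)) := by gcongr
        _ ≤ max A B * (4 * (1 + |ξ|) ^ (2 * s - 2)) := by
          gcongr ?_ * (4 * ?_)
          exact Real.rpow_le_rpow_of_nonpos (by linarith) (by linarith) (by linarith)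
        _ = _ := by ring
    · calc
        Stilde1 s ξ * |ξ| ^ (2 * s - 2)
          ≤ max A B * (1 * |ξ| ^ (2 * s - 2)) := by
            rw [one_mul]
            gcongr
            exact (Stilde1_le_const h0 (by linarith) ξ).trans (le_max_right _ _)
        _ ≤ max A B * (4 * 2 ^ (2 * s - 2) * |ξ| ^ (2 * s - 2)) := by gcongr
        _ = max A B * (4 * (2 * |ξ|) ^ (2 * s - 2)) := by
          rw [Real.mul_rpow two_pos.le hξ'.le]; ring
        _ ≤ max A B * (4 * (1 + |ξ|) ^ (2 * s - 2)) := by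
          gcongr ?_ * (4 * ?_)
          exact Real.rpow_le_rpow_of_nonpos (by linarith) (by linarith) (by linarith)
        _ = _ := by ring

/-- A form of the Riemann–Lebesgue lemma for the cosine transform. -/
lemma tendsto_integral_mul_cos {f : ℝ → ℝ} (hf : Integrable f) :
    Tendsto (fun r : ℝ => ∫ x, f x * Real.cos (2 * (r * x))) atTop (nhds 0) := by
  have hRL := (Real.tendsto_integral_exp_smul_cocompact (fun x => (f x : ℂ))).comp
    ((tendsto_id.atTop_div_const Real.pi_pos).mono_right atTop_le_cocompact)
  have hre := (Complex.continuous_re.tendsto 0).comp hRL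
  rw [Complex.zero_re] at hre
  refine hre.congr fun r => ?_
  have hint : Integrable
      (fun x => Real.fourierChar (-(x * (id r / Real.pi))) • (f x : ℂ)) := by
    simpa [mul_comm] using (Real.fourierIntegral_convergent_iff (r / Real.pi)).2 (hf.ofReal (𝕜 := ℂ))
  simp only [Function.comp_apply]
  rw [← Complex.reCLM_apply, ← Complex.reCLM.integral_comp_comm hint]
  refine integral_congr_ae (Eventually.of_forall fun x => ?_)
  have hpi : 2 * Real.pi * (-(x * (r / Real.pi))) = -(2 * (r * x)) := by
    field_simp
  simp only [Complex.reCLM_apply, Circle.smul_def, Real.fourierChar_apply, id, hpi,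
    smul_eq_mul, Complex.re_mul_ofReal, Complex.exp_ofReal_mul_I_re, Real.cos_neg]
  ring

lemma symbolS1_mul_sin_sq {s ξ : ℝ} (r : ℝ) (hξ : ξ ≠ 0) :
    symbolS1 s ξ * (4 * Real.sin (r * ξ) ^ 2 / ξ ^ 2) =
      2 * (Stilde1 s ξ * |ξ| ^ (2 * s - 2)) -
        2 * (Stilde1 s ξ * |ξ| ^ (2 * s - 2) * Real.cos (2 * (r * ξ))) := by
  rw [symbolS1, Real.rpow_sub (abs_pos.2 hξ), Real.rpow_two, sq_abs, Real.cos_two_mul,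
    Real.cos_sq']
  ring

/-- Proposition 1.4, behavior at infinity: `T_s(r) → 2 ∫_ℝ S̃_s(ξ) |ξ|^{2s-2} dξ` as
`r → +∞`, a finite positive constant depending only on `s`. -/
theorem stmt14 (s : ℝ) (hs : s ∈ Set.Ioo (0 : ℝ) (1 / 2)) :
    Tendsto (fun r : ℝ => Ts s r) atTop
      (nhds (2 * ∫ ξ : ℝ, Stilde1 s ξ * |ξ| ^ (2 * s - 2))) ∧
    Integrable (fun ξ : ℝ => Stilde1 s ξ * |ξ| ^ (2 * s - 2)) ∧
    0 < 2 * ∫ ξ : ℝ, Stilde1 s ξ * |ξ| ^ (2 * s - 2) := by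
  obtain ⟨h0, h1⟩ := hs
  have hint := integrable_Stilde1_mul_rpow h0 h1
  refine ⟨?_, hint, ?_⟩
  · have hcos (r : ℝ) : Integrable
        (fun ξ : ℝ => Stilde1 s ξ * |ξ| ^ (2 * s - 2) * Real.cos (2 * (r * ξ))) :=
      hint.mul_bdd (c := 1) (by fun_prop)
        (Eventually.of_forall fun ξ => Real.abs_cos_le_one _)
    have hTs (r : ℝ) : Ts s r = 2 * (∫ ξ : ℝ, Stilde1 s ξ * |ξ| ^ (2 * s - 2)) -
        2 * ∫ ξ : ℝ, Stilde1 s ξ * |ξ| ^ (2 * s - 2) * Real.cos (2 * (r * ξ)) := by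
      rw [← integral_const_mul, ← integral_const_mul,
        ← integral_sub (hint.const_mul 2) ((hcos r).const_mul 2)]
      refine integral_congr_ae ?_
      filter_upwards [Measure.ae_ne volume (0 : ℝ)] with ξ hξ
      exact symbolS1_mul_sin_sq r hξ
    simp_rw [hTs]
    simpa using ((tendsto_integral_mul_cos hint).const_mul 2).const_sub
      (2 * ∫ ξ : ℝ, Stilde1 s ξ * |ξ| ^ (2 * s - 2))
  · refine mul_pos two_pos ((integral_pos_iff_support_of_nonneg (fun ξ =>
      mul_nonneg (Stilde1_nonneg h0 (by linarith) ξ) (by positivity)) hint).2 ?_)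
    refine lt_of_lt_of_le ?_ (measure_mono (s := Set.Ioi 0) fun ξ (hξ : 0 < ξ) => ?_)
    · simp
    · exact (mul_pos (Stilde1_pos h0 (by linarith) hξ.ne')
        (Real.rpow_pos_of_pos (abs_pos.2 hξ.ne') _)).ne'
end
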